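/- arXiv:1710.03662 — 3 statements merged into one kernel-verified Lean document; each statement's English description precedes it below -/
import Mathlib

section
/- Let n ≥ 3 be an odd integer not divisible by 3 and let q be an odd prime. Then for all but finitely many odd primes p with q² < pⁿ, n divides the class number of K_{p,q} = Q(√(q² − pⁿ)). -/
open NumberField

/-- The Lucas sequence `V` with parameters `t` and `N`: if `t = a + b` and `N = a * b`, its `k`-th
term is `a ^ k + b ^ k`. -/
def lucasV {R : Type*} [CommRing R] (t N : R) : ℕ → R
  | 0 => 2
  | 1 => t
  | k + 2 => t * lucasV t N (k + 1) - N * lucasV t N k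

lemma lucasV_add_mul {R : Type*} [CommRing R] (a b : R) (k : ℕ) :
    lucasV (a + b) (a * b) k = a ^ k + b ^ k := by
  induction k using Nat.twoStepInduction with
  | zero => simp [lucasV]; norm_num
  | one => simp [lucasV]
  | more k ih₀ ih₁ => rw [lucasV, ih₀, ih₁]; ring

lemma map_lucasV {R S : Type*} [CommRing R] [CommRing S] (f : R →+* S) (t N : R) (k : ℕ) :
    f (lucasV t N k) = lucasV (f t) (f N) k := by
  induction k using Nat.twoStepInduction with
  | zero => simp only [lucasV, map_ofNat]
  | one => simp [lucasV]
  | more k ih₀ ih₁ => simp only [lucasV, map_sub, map_mul, ih₀, ih₁]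

lemma dvd_lucasV {R : Type*} [CommRing R] (t N : R) {k : ℕ} (hk : Odd k) :
    t ∣ lucasV t N k := by
  obtain ⟨j, rfl⟩ := hk
  induction j with
  | zero => simp [lucasV]
  | succ j ih =>
    exact dvd_sub (dvd_mul_right _ _) (ih.mul_left _)

open Polynomial in
/-- For fixed `t ≠ 0` and `k ≥ 2`, the Lucas sequence takes each value for finitely many `N`. -/
lemma finite_setOf_lucasV_eq {t c : ℤ} (ht : t ≠ 0) {k : ℕ} (hk : 1 < k) :
    {N : ℤ | lucasV t N k = c}.Finite := by
  let P : ℚ[X] := lucasV (C (t : ℚ)) X k - C (c : ℚ)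
  have heval (x : ℚ) : P.eval x = lucasV (t : ℚ) x k - c := by
    have h := map_lucasV (evalRingHom x) (C (t : ℚ)) X k
    simp only [coe_evalRingHom, eval_C, eval_X] at h
    simp only [P, eval_sub, eval_C, h]
  have hP : P ≠ 0 := by
    intro h
    have h₀ := heval 0
    have h₁ := heval ((t / 2 : ℚ) * (t / 2))
    have e₀ := lucasV_add_mul (t : ℚ) 0 k
    have e₁ := lucasV_add_mul (t / 2 : ℚ) (t / 2) k
    rw [add_halves] at e₁
    rw [add_zero, mul_zero, zero_pow (by omega)] at e₀
    rw [h, eval_zero, e₀] at h₀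
    rw [h, eval_zero, e₁, div_pow] at h₁
    have ht' : (t : ℚ) ^ k ≠ 0 := by positivity
    have h₂ : (t : ℚ) ^ k * (2 ^ k - 2) = 0 := by
      have : (t : ℚ) ^ k = 2 * (t ^ k / 2 ^ k) := by linarith
      field_simp at this
      linear_combination (t : ℚ) ^ k * this
    have h₃ : (2 : ℚ) ^ 1 < 2 ^ k := pow_lt_pow_right₀ (by norm_num) hk
    rcases mul_eq_zero.mp h₂ with h | h
    · exact ht' h
    · linarith
  refine ((P.rootSet_finite ℚ).preimage (f := fun N : ℤ ↦ (N : ℚ))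
    Int.cast_injective.injOn).subset fun N hN ↦ ?_
  have hN' : lucasV (t : ℚ) (N : ℚ) k = c := by
    rw [← hN]
    exact (map_lucasV (Int.castRingHom ℚ) t N k).symm
  simp [mem_rootSet, hP, heval, hN']

open nonZeroDivisors in
/-- If two coprime elements of a Dedekind domain multiply to an `n`-th power, then either `n`
divides the class number or each is associated to an `l`-th power for some divisor `l > 1`
of `n`. -/
lemma dvd_card_classGroup_or_exists_associated_pow {R : Type*} [CommRing R] [IsDedekindDomain R]
    {a b c : R} {n : ℕ} (hn : n ≠ 0) (ha : a ≠ 0) (hab : IsCoprime a b) (h : a * b = c ^ n) :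
    n ∣ Nat.card (ClassGroup R) ∨ ∃ l, l ∣ n ∧ 1 < l ∧ ∃ β : R, Associated (β ^ l) a := by
  obtain ⟨I, hI⟩ : ∃ I : Ideal R, Ideal.span {a} = I ^ n := by
    refine exists_eq_pow_of_mul_eq_pow_of_coprime (b := Ideal.span {b}) (c := Ideal.span {c}) ?_ ?_
    · rwa [Ideal.isCoprime_span_singleton_iff]
    · rw [Ideal.span_singleton_mul_span_singleton, h, Ideal.span_singleton_pow]
  have hI₀ : I ∈ (Ideal R)⁰ := by
    refine mem_nonZeroDivisors_of_ne_zero fun h₀ ↦ ha ?_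
    rw [h₀, zero_pow hn] at hI
    simpa using hI
  have hpow (k : ℕ) : ClassGroup.mk0 ⟨I, hI₀⟩ ^ k = 1 ↔ (I ^ k).IsPrincipal := by
    rw [← map_pow]
    exact ClassGroup.mk0_eq_one_iff (pow_mem hI₀ k)
  set g := ClassGroup.mk0 (⟨I, hI₀⟩ : (Ideal R)⁰)
  have hg : g ^ n = 1 := (hpow n).2 (hI ▸ ⟨a, rfl⟩)
  obtain ⟨l, hl⟩ := orderOf_dvd_of_pow_eq_one hg
  rcases lt_trichotomy l 1 with h₁ | rfl | h₁
  · obtain rfl : l = 0 := by omega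
    simp [hn] at hl
  · left
    rw [hl, mul_one]
    exact orderOf_dvd_natCard g
  · right
    refine ⟨l, ⟨_, hl.trans (mul_comm _ _)⟩, h₁, ?_⟩
    obtain ⟨β, hβ⟩ := (hpow _).1 (pow_orderOf_eq_one g)
    refine ⟨β, ?_⟩
    rw [← Ideal.span_singleton_eq_span_singleton, ← Ideal.span_singleton_pow, hI, hl, pow_mul, hβ]

/-- A complex square root of a negative integer is purely imaginary. -/
lemma conj_eq_neg_of_sq_eq_intCast {z : ℂ} {D : ℤ} (hD : D < 0) (hz : z ^ 2 = (D : ℂ)) :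
    starRingEnd ℂ z = -z := by
  have hD' : (D : ℝ) < 0 := by exact_mod_cast hD
  have hre := congrArg Complex.re hz
  have him := congrArg Complex.im hz
  simp only [pow_two, Complex.mul_re, Complex.mul_im, Complex.intCast_re, Complex.intCast_im]
    at hre him
  have hz₀ : z.re = 0 := by
    rcases mul_eq_zero.mp (show z.re * z.im = 0 by linarith) with h | h
    · exact h
    · rw [h] at hre
      nlinarith [mul_self_nonneg z.re]
  apply Complex.ext <;> simp [hz₀]

/-- Norms and traces from a quadratic field generated by the root of a negative integer, computed
in a complex embedding. -/
lemma exists_int_trace_norm {K : Type*} [Field K] [NumberField K] (hK : Module.finrank ℚ K = 2)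
    {x : K} {D : ℤ} (hD : D < 0) (hx : x ^ 2 = (D : K)) (φ : K →+* ℂ) (y : 𝓞 K) :
    ∃ t N : ℤ, φ y + starRingEnd ℂ (φ y) = t ∧ φ y * starRingEnd ℂ (φ y) = N := by
  have hφx : φ x ^ 2 = (D : ℂ) := by rw [← map_pow, hx, map_intCast]
  have hconj := conj_eq_neg_of_sq_eq_intCast hD hφx
  have hx₀ : (φ x).re = 0 := by
    have h := congrArg Complex.re hconj
    rw [Complex.conj_re, Complex.neg_re] at h
    linarith
  have hx₁ : (φ x).im ≠ 0 := fun h ↦ by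
    rw [Complex.ext (z := φ x) (w := 0) hx₀ h, zero_pow two_ne_zero] at hφx
    exact hD.ne (by exact_mod_cast hφx.symm)
  have hli : LinearIndependent ℚ ![(1 : K), x] := by
    rw [LinearIndependent.pair_iff]
    intro s r hsr
    have h := congrArg φ hsr
    simp only [Algebra.smul_def, map_add, map_mul, eq_ratCast, map_ratCast, mul_one,
      map_zero] at h
    have h₁ := congrArg Complex.re h
    have h₂ := congrArg Complex.im h
    simp only [Complex.add_re, Complex.add_im, Complex.mul_re, Complex.mul_im, Complex.ratCast_re,
      Complex.ratCast_im, hx₀, mul_zero, zero_mul, sub_zero, add_zero, zero_add, Complex.zero_re,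
      Complex.zero_im] at h₁ h₂
    refine ⟨by exact_mod_cast h₁, ?_⟩
    exact_mod_cast (mul_eq_zero.mp h₂).resolve_right hx₁
  have hspan := hli.span_eq_top_of_card_eq_finrank (by simp [hK])
  have hy : (y : K) ∈ Submodule.span ℚ (Set.range ![(1 : K), x]) := hspan ▸ Submodule.mem_top
  rw [Matrix.range_cons, Matrix.range_cons, Matrix.range_empty, Set.union_empty,
    Set.singleton_union, Submodule.mem_span_pair] at hy
  obtain ⟨a, b, hab⟩ := hy
  have hφy : φ y = a + b * φ x := by
    rw [← hab]
    simp [Algebra.smul_def]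
  have hcy : starRingEnd ℂ (φ y) = a - b * φ x := by
    rw [hφy, map_add, map_mul, hconj]
    simp
    ring
  have hint : IsIntegral ℤ (φ y) := y.2.map (φ.toIntAlgHom)
  have hcint : IsIntegral ℤ (starRingEnd ℂ (φ y)) := hint.map ((starRingEnd ℂ).toIntAlgHom)
  have key (r : ℚ) (hr : IsIntegral ℤ (r : ℂ)) : ∃ m : ℤ, (r : ℂ) = m := by
    have h : IsIntegral ℤ r := by
      refine (isIntegral_algHom_iff (algebraMap ℚ ℂ).toIntAlgHom
        (algebraMap ℚ ℂ).injective).1 ?_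
      simpa using hr
    obtain ⟨m, hm⟩ := IsIntegrallyClosed.isIntegral_iff.1 h
    exact ⟨m, by rw [← hm]; simp⟩
  have ht : φ y + starRingEnd ℂ (φ y) = ((2 * a : ℚ) : ℂ) := by
    rw [hcy, hφy]; push_cast; ring
  have hN : φ y * starRingEnd ℂ (φ y) = ((a ^ 2 - b ^ 2 * D : ℚ) : ℂ) := by
    rw [hcy, hφy]; push_cast; linear_combination -(b : ℂ) ^ 2 * hφx
  obtain ⟨t, ht'⟩ := key _ (ht ▸ hint.add hcint)
  obtain ⟨N, hN'⟩ := key _ (hN ▸ hint.mul hcint)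
  exact ⟨t, N, ht.trans ht', hN.trans hN'⟩

/-- Units of an imaginary quadratic field are roots of unity of order dividing `12`. -/
lemma unit_pow_twelve {K : Type*} [Field K] [NumberField K] (hK : Module.finrank ℚ K = 2)
    {x : K} {D : ℤ} (hD : D < 0) (hx : x ^ 2 = (D : K)) (u : (𝓞 K)ˣ) : u ^ 12 = 1 := by
  let φ : K →+* ℂ := Classical.arbitrary _
  obtain ⟨t, N, ht, hN⟩ := exists_int_trace_norm hK hD hx φ (u : 𝓞 K)
  obtain ⟨-, M, -, hM⟩ := exists_int_trace_norm hK hD hx φ ((u⁻¹ : (𝓞 K)ˣ) : 𝓞 K)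
  set z := φ (u : 𝓞 K)
  set w := φ ((u⁻¹ : (𝓞 K)ˣ) : 𝓞 K)
  have hzw : z * w = 1 := by
    rw [← map_mul, ← map_mul, Units.mul_inv, map_one, map_one]
  have hNM : N * M = 1 := by
    have : (N : ℂ) * M = (z * w) * starRingEnd ℂ (z * w) := by
      rw [← hN, ← hM, map_mul]; ring
    rw [hzw, map_one, mul_one] at this
    exact_mod_cast this
  rw [Complex.mul_conj] at hN
  have hN₀ : (Complex.normSq z : ℝ) = N := by exact_mod_cast hN
  have hN₁ : N = 1 := by
    rcases Int.eq_one_or_neg_one_of_mul_eq_one hNM with h | h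
    · exact h
    · have := Complex.normSq_nonneg z
      rw [hN₀, h] at this
      norm_num at this
  have htr : 2 * z.re = t := by
    have := congrArg Complex.re ht
    simp at this
    linarith
  have htsq : t ^ 2 ≤ 4 := by
    have h : (t : ℝ) ^ 2 ≤ 4 := by
      rw [Complex.normSq_apply, hN₁] at hN₀
      rw [← htr]
      push_cast at hN₀
      nlinarith [mul_self_nonneg z.im]
    exact_mod_cast h
  have hz : z ^ 2 - t * z + 1 = 0 := by
    have h₁ : z * starRingEnd ℂ z = 1 := by
      rw [Complex.mul_conj, hN, hN₁]; simp
    rw [← ht]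
    linear_combination -h₁
  have hz₁₂ : z ^ 12 = 1 := by
    have h₁ : t ≤ 2 := by nlinarith
    have h₂ : -2 ≤ t := by nlinarith
    interval_cases t
    · have : z = -1 := by
        have h : (z + 1) ^ 2 = 0 := by push_cast at hz; linear_combination hz
        exact eq_neg_of_add_eq_zero_left (pow_eq_zero_iff (two_ne_zero) |>.1 h)
      rw [this]; norm_num
    · have h : z ^ 3 = 1 := by push_cast at hz; linear_combination (z - 1) * hz
      linear_combination (z ^ 9 + z ^ 6 + z ^ 3 + 1) * h
    · have h : z ^ 2 = -1 := by push_cast at hz; linear_combination hz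
      linear_combination (z ^ 10 - z ^ 8 + z ^ 6 - z ^ 4 + z ^ 2 - 1) * h
    · have h : z ^ 3 = -1 := by push_cast at hz; linear_combination (z + 1) * hz
      linear_combination (z ^ 9 - z ^ 6 + z ^ 3 - 1) * h
    · have : z = 1 := by
        have h : (z - 1) ^ 2 = 0 := by push_cast at hz; linear_combination hz
        exact sub_eq_zero.1 (pow_eq_zero_iff (two_ne_zero) |>.1 h)
      rw [this]; norm_num
  ext
  apply φ.injective
  simpa [z] using hz₁₂

/-- If `n` does not divide the class number of `ℚ(√(q² - pⁿ))`, then `2 q` and `pⁿ` come from a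
Lucas sequence of index a divisor of `n`. -/
lemma dvd_classNumber_or_exists_lucasV {n p q : ℕ} (hn : n ≠ 0) (hnodd : Odd n) (hn3 : ¬ 3 ∣ n)
    (hpq : IsCoprime (p : ℤ) (2 * q)) (hlt : (q : ℤ) ^ 2 < (p : ℤ) ^ n)
    {K : Type*} [Field K] [NumberField K] {x : K}
    (hx : x ^ 2 = (((q : ℤ) ^ 2 - (p : ℤ) ^ n : ℤ) : K)) (hK : Module.finrank ℚ K = 2) :
    n ∣ classNumber K ∨
      ∃ l, l ∣ n ∧ 1 < l ∧ ∃ t N : ℤ, lucasV t N l = 2 * q ∧ N ^ l = (p : ℤ) ^ n := by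
  have hD : (q : ℤ) ^ 2 - (p : ℤ) ^ n < 0 := by linarith
  have hxint : IsIntegral ℤ x := by
    refine IsIntegral.of_pow (n := 2) (by norm_num) ?_
    rw [hx]
    exact isIntegral_algebraMap (R := ℤ) (A := K)
  let ξ : 𝓞 K := ⟨x, hxint⟩
  have hξ : ξ ^ 2 = (q : 𝓞 K) ^ 2 - (p : 𝓞 K) ^ n := by
    apply RingOfIntegers.coe_injective
    rw [map_pow, map_sub, map_pow, map_pow, map_natCast, map_natCast]
    exact hx.trans (by push_cast; rfl)
  have hmul : (q + ξ) * (q - ξ) = (p : 𝓞 K) ^ n := by linear_combination -hξ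
  have hp : (p : 𝓞 K) ≠ 0 := by
    have : p ≠ 0 := by
      rintro rfl
      rw [Nat.cast_zero, zero_pow hn] at hlt
      nlinarith [sq_nonneg (q : ℤ)]
    exact_mod_cast this
  have ha : (q + ξ : 𝓞 K) ≠ 0 := left_ne_zero_of_mul (hmul ▸ pow_ne_zero n hp)
  have hcop : IsCoprime (q + ξ : 𝓞 K) (q - ξ) := by
    obtain ⟨r, s, hrs⟩ := hpq.pow_left (m := n)
    have h := congrArg (fun m : ℤ ↦ (m : 𝓞 K)) hrs
    push_cast at h
    rw [← hmul] at h
    exact ⟨r * (q - ξ) + s, s, by linear_combination h⟩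
  refine (dvd_card_classGroup_or_exists_associated_pow hn ha hcop hmul).imp (fun h ↦ ?_) ?_
  · rwa [Nat.card_eq_fintype_card] at h
  rintro ⟨l, hln, hl, β, u, hu⟩
  have hl12 : Nat.Coprime l 12 := by
    have h2 : Nat.Coprime l 2 := Nat.coprime_two_right.2 (hnodd.of_dvd_nat hln)
    have h3 : Nat.Coprime l 3 := ((Nat.Prime.coprime_iff_not_dvd Nat.prime_three).2
      fun h ↦ hn3 (h.trans hln)).symm
    exact (h2.mul_right h2).mul_right h3
  obtain ⟨v, rfl⟩ : ∃ v : (𝓞 K)ˣ, v ^ l = u := by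
    obtain ⟨v, hv⟩ := exists_pow_eq_self_of_coprime (x := u) (n := l)
      (hl12.coprime_dvd_right (orderOf_dvd_of_pow_eq_one (unit_pow_twelve hK hD hx u)))
    exact ⟨u ^ v, by rw [← pow_mul, mul_comm, pow_mul, hv]⟩
  let φ : K →+* ℂ := Classical.arbitrary _
  obtain ⟨t, N, ht, hN⟩ := exists_int_trace_norm hK hD hx φ (β * v)
  have hγ : (β * v) ^ l = q + ξ := by rw [mul_pow, ← hu]; rfl
  have hφγ : φ (β * v : 𝓞 K) ^ l = q + φ x := by
    rw [← map_pow, ← map_pow, hγ, map_add, map_natCast, map_add, map_natCast]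
    rfl
  have hφx : φ x ^ 2 = (q : ℂ) ^ 2 - (p : ℂ) ^ n := by
    rw [← map_pow, hx, map_intCast]
    push_cast
    rfl
  have hconj : starRingEnd ℂ (φ x) = -φ x :=
    conj_eq_neg_of_sq_eq_intCast hD (by rw [hφx]; push_cast; rfl)
  have hcγ : starRingEnd ℂ (φ (β * v : 𝓞 K)) ^ l = q - φ x := by
    rw [← map_pow, hφγ, map_add, hconj, map_natCast, sub_eq_add_neg]
  refine ⟨l, hln, hl, t, N, ?_, ?_⟩
  · have h := lucasV_add_mul (φ (β * v : 𝓞 K)) (starRingEnd ℂ (φ (β * v : 𝓞 K))) l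
    rw [ht, hN, hφγ, hcγ] at h
    have h' := (map_lucasV (Int.castRingHom ℂ) t N l).trans h
    rw [eq_intCast, add_add_sub_cancel, ← two_mul] at h'
    exact_mod_cast h'
  · have h : (N : ℂ) ^ l = (p : ℂ) ^ n := by
      rw [← hN, mul_pow, hφγ, hcγ]
      linear_combination -hφx
    exact_mod_cast h

theorem class_number_divisible_for_almost_all_p
    (n : ℕ) (hn : 3 ≤ n) (hnodd : Odd n) (hn3 : ¬ 3 ∣ n)
    (q : ℕ) (hq : q.Prime) (hqodd : Odd q) :
    {p : ℕ | p.Prime ∧ Odd p ∧ (q : ℤ) ^ 2 < (p : ℤ) ^ n ∧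
      ¬ ∀ (K : Type) [Field K] [NumberField K] (x : K),
          x ^ 2 = (((q : ℤ) ^ 2 - (p : ℤ) ^ n : ℤ) : K) → Module.finrank ℚ K = 2 →
            n ∣ classNumber K}.Finite := by
  have hfin : (⋃ l ∈ {l | l ∣ n ∧ 1 < l}, ⋃ t ∈ {t : ℤ | t ∣ 2 * q},
      ⋃ N ∈ {N : ℤ | lucasV t N l = 2 * q}, {p : ℕ | N ^ l = (p : ℤ) ^ n}).Finite := by
    have hq₀ : (2 * q : ℤ) ≠ 0 := by exact_mod_cast (Nat.mul_pos two_pos hq.pos).ne'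
    refine Set.Finite.biUnion ?_ fun l hl ↦ Set.Finite.biUnion ?_ fun t ht ↦
      Set.Finite.biUnion (finite_setOf_lucasV_eq (ne_zero_of_dvd_ne_zero hq₀ ht) hl.2)
      fun N _ ↦ Set.Subsingleton.finite fun a ha b hb ↦ ?_
    · exact n.divisors.finite_toSet.subset fun l hl ↦ by simp [hl.1]; omega
    · refine (Set.finite_Icc (-(2 * q : ℤ)) (2 * q)).subset fun t ht ↦ ?_
      have hpos : (0 : ℤ) < 2 * q := by exact_mod_cast Nat.mul_pos two_pos hq.pos
      exact ⟨neg_le.1 (Int.le_of_dvd hpos (neg_dvd.2 ht)), Int.le_of_dvd hpos ht⟩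
    · have h : a ^ n = b ^ n := by exact_mod_cast ha.symm.trans hb
      exact Nat.pow_left_injective (by omega) h
  refine (hfin.insert q).subset ?_
  rintro p ⟨hp, hpodd, hlt, hcl⟩
  push Not at hcl
  obtain ⟨K, _, _, x, hx, hK, hdvd⟩ := hcl
  by_cases hpq : p = q
  · exact Or.inl hpq
  right
  have hcop : IsCoprime (p : ℤ) (2 * q) := by
    have : p.Coprime (2 * q) := Nat.Coprime.mul_right (Nat.coprime_two_right.2 hpodd)
      ((Nat.coprime_primes hp hq).2 hpq)
    exact_mod_cast Nat.isCoprime_iff_coprime.2 this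
  obtain ⟨l, hln, hl, t, N, hV, hN⟩ := (dvd_classNumber_or_exists_lucasV (by omega) hnodd hn3 hcop
    hlt hx hK).resolve_left hdvd
  simp only [Set.mem_iUnion]
  exact ⟨l, ⟨hln, hl⟩, t, hV ▸ dvd_lucasV t N (hnodd.of_dvd_nat hln), N, hV, hN⟩
end

section
/- Let n be a positive odd integer and p an odd prime with (p, n) ≠ (3, 5) and pⁿ > 1. Then n divides the class number of the imaginary quadratic field Q(√(1 − pⁿ)). -/
open NumberField

theorem Prime.pow_succ_dvd_of_pow_add_dvd_mul {M : Type*} [CommMonoidWithZero M]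
    [IsCancelMulZero M] {r x y : M} (hr : Prime r) {a b : ℕ} (hxy : r ^ (a + b) ∣ x * y)
    (hx : ¬ r ^ b ∣ x) : r ^ (a + 1) ∣ y := by
  induction b generalizing x with
  | zero => simp at hx
  | succ b ih =>
    by_cases hrx : r ∣ x
    · obtain ⟨z, rfl⟩ := hrx
      refine ih (x := z) ?_ fun h ↦ hx ?_
      · rw [← add_assoc, pow_succ', mul_assoc] at hxy
        exact (mul_dvd_mul_iff_left hr.ne_zero).1 hxy
      · rw [pow_succ']
        exact mul_dvd_mul_left r h
    · exact (pow_dvd_pow r (by lia)).trans (hr.pow_dvd_of_dvd_mul_left _ hrx hxy)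

theorem Nat.Prime.not_pow_dvd_choose_two {r e j : ℕ} (hr : r.Prime) (he : 4 ≤ r ^ e)
    (hj : 2 ≤ j) : ¬ r ^ (e * (j - 1)) ∣ (2 * j).choose 2 := by
  have hlt : 2 * j - 1 < r ^ (e * (j - 1)) := by
    obtain ⟨i, rfl⟩ : ∃ i, j = i + 2 := ⟨j - 2, by lia⟩
    rw [pow_mul]
    refine lt_of_lt_of_le ?_ (Nat.pow_le_pow_left he _)
    clear he
    induction i with
    | zero => norm_num
    | succ i ih => rw [show i + 1 + 2 - 1 = (i + 2 - 1) + 1 by lia, pow_succ]; lia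
  have hchoose : (2 * j).choose 2 = j * (2 * j - 1) := by
    rw [Nat.choose_two_right, mul_assoc, Nat.mul_div_cancel_left _ two_pos]
  have hcop : Nat.Coprime j (2 * j - 1) := by
    rw [show 2 * j - 1 = (j - 1) + j by lia, Nat.coprime_add_self_right]
    exact (Nat.coprime_self_sub_right (by lia)).2 (Nat.coprime_one_right j)
  rw [hchoose, (hcop.isPrimePow_dvd_mul ?_)]
  · rintro (h | h) <;> have := Nat.le_of_dvd (by lia) h <;> lia
  · refine hr.isPrimePow.pow (Nat.mul_ne_zero ?_ (by lia))
    rintro rfl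
    norm_num at he

namespace Zsqrtd

variable {d : ℤ}

theorem re_sum {ι : Type*} (s : Finset ι) (f : ι → ℤ√d) :
    (∑ i ∈ s, f i).re = ∑ i ∈ s, (f i).re :=
  map_sum (AddMonoidHom.mk' (fun z : ℤ√d ↦ z.re) re_add) f s

theorem sqrtd_pow_two_mul (j : ℕ) : (sqrtd : ℤ√d) ^ (2 * j) = ((d ^ j : ℤ) : ℤ√d) := by
  rw [pow_mul, sq, dmuld]; push_cast; rfl

theorem re_one_add_sqrtd_pow (q : ℕ) :
    ((1 + sqrtd : ℤ√d) ^ q).re =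
      ∑ k ∈ Finset.range (q + 1), (q.choose k : ℤ) * ((sqrtd : ℤ√d) ^ k).re := by
  rw [add_comm, add_pow, re_sum]
  refine Finset.sum_congr rfl fun k _ ↦ ?_
  simp [mul_comm]

theorem re_one_add_sqrtd_pow_ne_one {r e q : ℕ} (hr : r.Prime) (he : 4 ≤ r ^ e)
    (hd : d ≠ 0) (hrd : (r : ℤ) ^ e ∣ d) (hq : 2 ≤ q) : ((1 + sqrtd : ℤ√d) ^ q).re ≠ 1 := by
  intro h
  have hr' : Prime (r : ℤ) := Nat.prime_iff_prime_int.1 hr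
  have hne : (q.choose 2 : ℤ) * d ≠ 0 :=
    mul_ne_zero (by exact_mod_cast (Nat.choose_pos hq).ne') hd
  obtain ⟨v, hv, hv'⟩ : ∃ v : ℕ, (r : ℤ) ^ v ∣ q.choose 2 * d ∧
      ¬ (r : ℤ) ^ (v + 1) ∣ q.choose 2 * d := by
    have hfin : FiniteMultiplicity (r : ℤ) (q.choose 2 * d) :=
      FiniteMultiplicity.of_prime_left hr' hne
    exact hfin.exists_eq_pow_mul_and_not_dvd.elim fun c hc ↦
      ⟨_, pow_multiplicity_dvd _ _, hfin.not_pow_dvd_of_multiplicity_lt (Nat.lt_succ_self _)⟩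
  have hterm : ∀ k, 3 ≤ k → (r : ℤ) ^ (v + 1) ∣ q.choose k * ((sqrtd : ℤ√d) ^ k).re := by
    intro k hk
    obtain ⟨j, rfl | rfl⟩ := Nat.even_or_odd' k
    · have hj : 2 ≤ j := by lia
      rw [sqrtd_pow_two_mul, re_intCast]
      rcases lt_or_ge q (2 * j) with hlt | hle
      · simp [Nat.choose_eq_zero_of_lt hlt]
      refine hr'.pow_succ_dvd_of_pow_add_dvd_mul (b := e * (j - 1)) (x := ((2 * j).choose 2 : ℤ))
        ?_ ?_
      · have hc : (q.choose (2 * j) : ℤ) * (2 * j).choose 2 =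
            q.choose 2 * (q - 2).choose (2 * j - 2) := by
          exact_mod_cast Nat.choose_mul (n := q) (k := 2 * j) (s := 2) (by lia)
        have : ((2 * j).choose 2 : ℤ) * (q.choose (2 * j) * d ^ j) =
            (q.choose 2 * d) * (d ^ (j - 1) * (q - 2).choose (2 * j - 2)) := by
          obtain ⟨i, rfl⟩ : ∃ i, j = i + 1 := ⟨j - 1, by lia⟩
          rw [Nat.add_sub_cancel, pow_succ]
          linear_combination (d ^ i * d) * hc
        rw [this, pow_add, pow_mul]
        exact mul_dvd_mul hv ((pow_dvd_pow_of_dvd hrd _).mul_right _)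
      · exact_mod_cast hr.not_pow_dvd_choose_two he hj
    · rw [pow_succ sqrtd, sqrtd_pow_two_mul, re_smul]
      simp
  rw [re_one_add_sqrtd_pow, show q + 1 = 3 + (q - 2) by lia, Finset.sum_range_add,
    Finset.sum_range_succ, Finset.sum_range_succ, Finset.sum_range_one] at h
  have h2 : ((sqrtd : ℤ√d) ^ 2).re = d := by simp [sq]
  rw [h2] at h
  simp only [Nat.choose_zero_right, pow_zero, re_one, pow_one, re_sqrtd] at h
  refine hv' ?_
  have h3 : (q.choose 2 : ℤ) * d =
      -∑ k ∈ Finset.range (q - 2), (q.choose (3 + k) : ℤ) * ((sqrtd : ℤ√d) ^ (3 + k)).re := by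
    push_cast at h ⊢
    linarith
  rw [h3, dvd_neg]
  exact Finset.dvd_sum fun k _ ↦ hterm _ (by lia)

end Zsqrtd

theorem exists_one_add_pow_two_pow_mul_eq {R : Type*} [CommRing R] {ε : R}
    (hε : 128 ∣ ε ^ 2) (i m : ℕ) :
    ∃ ω : R, (1 + ε) ^ (2 ^ i * m) = 1 + 2 ^ i * m * ε + 64 * 2 ^ i * ω := by
  obtain ⟨η, hη⟩ := hε
  induction i with
  | zero =>
    induction m with
    | zero => exact ⟨0, by simp⟩
    | succ m ih =>
      obtain ⟨ω, hω⟩ := ih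
      simp only [pow_zero, one_mul, mul_one] at hω ⊢
      refine ⟨ω + ω * ε + 2 * m * η, ?_⟩
      rw [pow_succ, hω]
      push_cast
      linear_combination (m : R) * hη
  | succ i ih =>
    obtain ⟨ω, hω⟩ := ih
    refine ⟨ω + 2 ^ i * (m ^ 2 * η + m * ε * ω + 32 * ω ^ 2), ?_⟩
    rw [pow_succ, mul_right_comm, pow_mul, hω, pow_succ]
    linear_combination (2 ^ i * m : R) ^ 2 * hη

namespace Zsqrtd

variable {d : ℤ} {ε : ℤ√d}

theorem exists_re_one_add_sqrtd_pow_eq (h8 : (1 + sqrtd : ℤ√d) ^ 8 = 1 + ε)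
    (hε : 128 ∣ ε ^ 2) (i m r : ℕ) :
    ∃ z : ℤ, ((1 + sqrtd : ℤ√d) ^ (8 * (2 ^ i * m) + r)).re =
      ((1 + sqrtd : ℤ√d) ^ r).re + 2 ^ i * (m * ((1 + sqrtd : ℤ√d) ^ r * ε).re + 64 * z) := by
  obtain ⟨ω, hω⟩ := exists_one_add_pow_two_pow_mul_eq hε i m
  refine ⟨((1 + sqrtd) ^ r * ω).re, ?_⟩
  have : (1 + sqrtd : ℤ√d) ^ (8 * (2 ^ i * m) + r) = (1 + sqrtd) ^ r +
      ((2 ^ i * m : ℤ) : ℤ√d) * ((1 + sqrtd) ^ r * ε) +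
      ((64 * 2 ^ i : ℤ) : ℤ√d) * ((1 + sqrtd) ^ r * ω) := by
    rw [pow_add, pow_mul, h8, hω]
    push_cast
    ring
  rw [this, re_add, re_add, re_smul, re_smul]
  ring

theorem re_one_add_sqrtd_pow_ne (h8 : (1 + sqrtd : ℤ√d) ^ 8 = 1 + ε) (hε : 128 ∣ ε ^ 2)
    {M : ℕ} (hM : M ≠ 0) {r : ℕ} (hr : ¬ 64 ∣ ((1 + sqrtd : ℤ√d) ^ r * ε).re) :
    ((1 + sqrtd : ℤ√d) ^ (8 * M + r)).re ≠ ((1 + sqrtd : ℤ√d) ^ r).re := by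
  obtain ⟨i, m, hm, rfl⟩ := Nat.exists_eq_two_pow_mul_odd hM
  obtain ⟨z, hz⟩ := exists_re_one_add_sqrtd_pow_eq h8 hε i m r
  rw [hz, ne_eq, add_eq_left, mul_eq_zero, not_or]
  refine ⟨by positivity, fun h ↦ hr ?_⟩
  have hcop : IsCoprime (64 : ℤ) m := by
    rw [show (64 : ℤ) = ((2 ^ 6 : ℕ) : ℤ) by norm_num, Nat.isCoprime_iff_coprime]
    exact (Nat.coprime_two_left.2 hm).pow_left 6
  exact hcop.dvd_of_dvd_mul_left ⟨-z, by linarith⟩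

theorem eq_five_of_re_one_add_sqrtd_neg_two_pow {q : ℕ} (hq : Odd q) (hq1 : q ≠ 1)
    (h : ((1 + sqrtd : ℤ√(-2)) ^ q).re = 1 ∨ ((1 + sqrtd : ℤ√(-2)) ^ q).re = -1) : q = 5 := by
  have h8 : (1 + sqrtd : ℤ√(-2)) ^ 8 = 1 + (⟨16, 56⟩ : ℤ√(-2)) := by decide
  have hε : (128 : ℤ√(-2)) ∣ (⟨16, 56⟩ : ℤ√(-2)) ^ 2 := ⟨⟨-47, 14⟩, by decide⟩
  have e1 : ((1 + sqrtd : ℤ√(-2)) ^ 1).re = 1 := by decide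
  have e3 : ((1 + sqrtd : ℤ√(-2)) ^ 3).re = -5 := by decide
  have e5 : ((1 + sqrtd : ℤ√(-2)) ^ 5).re = 1 := by decide
  have e7 : ((1 + sqrtd : ℤ√(-2)) ^ 7).re = 43 := by decide
  have f1 : ((1 + sqrtd : ℤ√(-2)) ^ 1 * (⟨16, 56⟩ : ℤ√(-2))).re = -96 := by decide
  have f3 : ((1 + sqrtd : ℤ√(-2)) ^ 3 * (⟨16, 56⟩ : ℤ√(-2))).re = -192 := by decide
  have f5 : ((1 + sqrtd : ℤ√(-2)) ^ 5 * (⟨16, 56⟩ : ℤ√(-2))).re = 1248 := by decide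
  have f7 : ((1 + sqrtd : ℤ√(-2)) ^ 7 * (⟨16, 56⟩ : ℤ√(-2))).re = -768 := by decide
  obtain ⟨M, r, hr, rfl⟩ : ∃ M r, r < 8 ∧ q = 8 * M + r :=
    ⟨q / 8, q % 8, Nat.mod_lt _ (by norm_num), (Nat.div_add_mod q 8).symm⟩
  have hr2 : r % 2 = 1 := by have := Nat.odd_iff.1 hq; lia
  obtain ⟨z, hz⟩ := exists_re_one_add_sqrtd_pow_eq h8 hε 0 M r
  have hne := fun hM ↦ re_one_add_sqrtd_pow_ne h8 hε (M := M) hM (r := r)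
  simp only [pow_zero, one_mul] at hz
  obtain rfl | rfl | rfl | rfl : r = 1 ∨ r = 3 ∨ r = 5 ∨ r = 7 := by lia
  · rw [e1, f1] at hz hne
    have := hne (by lia) (by norm_num)
    lia
  · rw [e3, f3] at hz
    lia
  · rw [e5, f5] at hz hne
    rcases eq_or_ne M 0 with rfl | hM
    · rfl
    have := hne hM (by norm_num)
    lia
  · rw [e7, f7] at hz
    lia

theorem re_one_add_sqrtd_neg_six_pow_ne_one {q : ℕ} (hq : Odd q) (hq1 : q ≠ 1) :
    ((1 + sqrtd : ℤ√(-6)) ^ q).re ≠ 1 := by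
  intro h
  have h8 : (1 + sqrtd : ℤ√(-6)) ^ 8 = 1 + (⟨-2400, -40⟩ : ℤ√(-6)) := by decide
  have hε : (128 : ℤ√(-6)) ∣ (⟨-2400, -40⟩ : ℤ√(-6)) ^ 2 := ⟨⟨44925, 1500⟩, by decide⟩
  have e1 : ((1 + sqrtd : ℤ√(-6)) ^ 1).re = 1 := by decide
  have e3 : ((1 + sqrtd : ℤ√(-6)) ^ 3).re = -17 := by decide
  have e5 : ((1 + sqrtd : ℤ√(-6)) ^ 5).re = 121 := by decide
  have e7 : ((1 + sqrtd : ℤ√(-6)) ^ 7).re = -377 := by decide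
  have f1 : ((1 + sqrtd : ℤ√(-6)) ^ 1 * (⟨-2400, -40⟩ : ℤ√(-6))).re = -2160 := by decide
  have f3 : ((1 + sqrtd : ℤ√(-6)) ^ 3 * (⟨-2400, -40⟩ : ℤ√(-6))).re = 40080 := by decide
  have f5 : ((1 + sqrtd : ℤ√(-6)) ^ 5 * (⟨-2400, -40⟩ : ℤ√(-6))).re = -294960 := by decide
  have f7 : ((1 + sqrtd : ℤ√(-6)) ^ 7 * (⟨-2400, -40⟩ : ℤ√(-6))).re = 985680 := by decide
  obtain ⟨M, r, hr, rfl⟩ : ∃ M r, r < 8 ∧ q = 8 * M + r :=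
    ⟨q / 8, q % 8, Nat.mod_lt _ (by norm_num), (Nat.div_add_mod q 8).symm⟩
  have hr2 : r % 2 = 1 := by have := Nat.odd_iff.1 hq; lia
  obtain ⟨z, hz⟩ := exists_re_one_add_sqrtd_pow_eq h8 hε 0 M r
  have hne := fun hM ↦ re_one_add_sqrtd_pow_ne h8 hε (M := M) hM (r := r)
  simp only [pow_zero, one_mul] at hz
  obtain rfl | rfl | rfl | rfl : r = 1 ∨ r = 3 ∨ r = 5 ∨ r = 7 := by lia
  · rw [e1, f1] at hz hne
    have := hne (by lia) (by norm_num)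
    lia
  · rw [e3, f3] at hz
    lia
  · rw [e5, f5] at hz
    lia
  · rw [e7, f7] at hz
    lia

theorem dvd_re_one_add_sqrtd_pow_sub_one (q : ℕ) : d ∣ ((1 + sqrtd : ℤ√d) ^ q).re - 1 := by
  induction q with
  | zero => simp
  | succ q ih =>
    obtain ⟨c, hc⟩ := ih
    refine ⟨c + ((1 + sqrtd : ℤ√d) ^ q).im, ?_⟩
    rw [pow_succ, re_mul]
    simp only [re_add, im_add, re_one, im_one, re_sqrtd, im_sqrtd]
    linear_combination hc

theorem eq_three_and_eq_five_of_re_one_add_sqrtd_pow {P q : ℕ} (hP : Odd P) (hP3 : 3 ≤ P)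
    (hq : Odd q) (hq1 : q ≠ 1) (h : ((1 + sqrtd : ℤ√(1 - P)) ^ q).re = 1 ∨
      ((1 + sqrtd : ℤ√(1 - P)) ^ q).re = -1) : P = 3 ∧ q = 5 := by
  have hq3 : 2 ≤ q := by have := hq.pos; lia
  have hP2 := Nat.odd_iff.1 hP
  have hP36 : P = 3 ∨ (P = 7 ∧ ((1 + sqrtd : ℤ√(1 - P)) ^ q).re = 1) := by
    rcases h with h | h
    · have h6 : P - 1 ∣ 6 := by
        rw [Nat.dvd_iff_prime_pow_dvd_dvd]
        intro r e hr hre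
        have hlt : r ^ e < 4 := by
          by_contra! hlt
          refine re_one_add_sqrtd_pow_ne_one (d := 1 - P) hr hlt (by lia) ?_ hq3 h
          rw [← dvd_neg, neg_sub, ← Nat.cast_pow, ← Nat.cast_one (R := ℤ),
            ← Nat.cast_sub (by lia)]
          exact_mod_cast hre
        have := pow_pos hr.pos e
        interval_cases r ^ e <;> norm_num
      have := Nat.le_of_dvd (by norm_num) h6
      have : P ≤ 7 := by lia
      interval_cases P <;> lia
    · have h2 : (1 - P : ℤ) ∣ 2 := by
        have := dvd_re_one_add_sqrtd_pow_sub_one (d := 1 - P) q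
        rw [h] at this
        exact (dvd_neg (b := (2 : ℤ))).1 this
      have := Int.le_of_dvd (by norm_num) ((neg_dvd).2 h2)
      lia
  obtain rfl | ⟨rfl, h'⟩ := hP36
  · exact ⟨rfl, eq_five_of_re_one_add_sqrtd_neg_two_pow hq hq1 h⟩
  · exact absurd h' (re_one_add_sqrtd_neg_six_pow_ne_one hq hq1)

end Zsqrtd

section QuadraticField

variable {K : Type*} [Field K] [Algebra ℚ K] {x : K} {N : ℚ}

theorem exists_basis_one_of_sq_eq_neg (hdeg : Module.finrank ℚ K = 2) (hN : 0 < N)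
    (hx : x ^ 2 = -algebraMap ℚ K N) : ∃ b : Module.Basis (Fin 2) ℚ K, b 0 = 1 ∧ b 1 = x := by
  have hli : LinearIndependent ℚ ![1, x] := by
    rw [LinearIndependent.pair_iff]
    intro s t h
    rw [Algebra.smul_def, Algebra.smul_def, mul_one] at h
    have h0 : algebraMap ℚ K (s ^ 2 + N * t ^ 2) = 0 := by
      simp only [map_add, map_mul, map_pow]
      linear_combination (algebraMap ℚ K s - algebraMap ℚ K t * x) * h +
        (algebraMap ℚ K t) ^ 2 * hx
    rw [map_eq_zero] at h0
    have ht : t = 0 := by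
      by_contra ht
      have : 0 < N * t ^ 2 := by positivity
      nlinarith [sq_nonneg s]
    subst ht
    exact ⟨by simpa using h0, rfl⟩
  exact ⟨basisOfLinearIndependentOfCardEqFinrank hli (by simp [hdeg]), by simp, by simp⟩

theorem exists_eq_add_mul_of_sq_eq_neg (hdeg : Module.finrank ℚ K = 2) (hN : 0 < N)
    (hx : x ^ 2 = -algebraMap ℚ K N) (z : K) :
    ∃ u v : ℚ, z = algebraMap ℚ K u + algebraMap ℚ K v * x := by
  obtain ⟨b, hb0, hb1⟩ := exists_basis_one_of_sq_eq_neg hdeg hN hx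
  refine ⟨b.repr z 0, b.repr z 1, ?_⟩
  conv_lhs => rw [← b.sum_repr z]
  simp [Fin.sum_univ_two, hb0, hb1, Algebra.smul_def]

theorem trace_and_norm_add_mul_of_sq_eq_neg (hdeg : Module.finrank ℚ K = 2) (hN : 0 < N)
    (hx : x ^ 2 = -algebraMap ℚ K N) (u v : ℚ) :
    Algebra.trace ℚ K (algebraMap ℚ K u + algebraMap ℚ K v * x) = 2 * u ∧
      Algebra.norm ℚ (algebraMap ℚ K u + algebraMap ℚ K v * x) = u ^ 2 + N * v ^ 2 := by
  obtain ⟨b, hb0, hb1⟩ := exists_basis_one_of_sq_eq_neg hdeg hN hx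
  set z := algebraMap ℚ K u + algebraMap ℚ K v * x with hz
  have h0 : z * b 0 = u • b 0 + v • b 1 := by
    simp [hb0, hb1, hz, Algebra.smul_def]
  have h1 : z * b 1 = (-(N * v)) • b 0 + u • b 1 := by
    simp only [hb0, hb1, hz, Algebra.smul_def, map_neg, map_mul]
    linear_combination algebraMap ℚ K v * hx
  have hM : Algebra.leftMulMatrix b z = !![u, -(N * v); v, u] := by
    ext i j
    rw [Algebra.leftMulMatrix_eq_repr_mul]
    fin_cases j
    · fin_cases i <;> simp [h0]
    · fin_cases i <;> simp [h1]
  rw [Algebra.trace_eq_matrix_trace b, Algebra.norm_eq_matrix_det b, hM, Matrix.trace_fin_two_of,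
    Matrix.det_fin_two_of]
  constructor <;> ring

theorem exists_trace_eq_and_norm_eq_of_sq_eq_neg (hdeg : Module.finrank ℚ K = 2) (hN : 0 < N)
    (hx : x ^ 2 = -algebraMap ℚ K N) (z : K) :
    ∃ u v : ℚ, z = algebraMap ℚ K u + algebraMap ℚ K v * x ∧ Algebra.trace ℚ K z = 2 * u ∧
      Algebra.norm ℚ z = u ^ 2 + N * v ^ 2 := by
  obtain ⟨u, v, rfl⟩ := exists_eq_add_mul_of_sq_eq_neg hdeg hN hx z
  exact ⟨u, v, rfl, trace_and_norm_add_mul_of_sq_eq_neg hdeg hN hx u v⟩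

end QuadraticField

namespace NumberField.RingOfIntegers

theorem trace_intCast_mul {K : Type*} [Field K] (m : ℤ) (β : 𝓞 K) :
    Algebra.trace ℤ (𝓞 K) (m * β) = m * Algebra.trace ℤ (𝓞 K) β := by
  rw [← zsmul_eq_mul, map_zsmul, smul_eq_mul]

variable {K : Type*} [Field K] [NumberField K] {x : K} {N : ℚ}

theorem sq_eq_trace_mul_sub_norm_of_sq_eq_neg (hdeg : Module.finrank ℚ K = 2) (hN : 0 < N)
    (hx : x ^ 2 = -algebraMap ℚ K N) (β : 𝓞 K) :
    β ^ 2 = (Algebra.trace ℤ (𝓞 K) β : 𝓞 K) * β - (Algebra.norm ℤ β : 𝓞 K) := by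
  obtain ⟨u, v, hz, ht, hn⟩ := exists_trace_eq_and_norm_eq_of_sq_eq_neg hdeg hN hx (β : K)
  apply RingOfIntegers.coe_injective
  have ht' : ((Algebra.trace ℤ (𝓞 K) β : ℤ) : K) = algebraMap ℚ K (2 * u) := by
    rw [← ht, ← Algebra.coe_trace_int, map_intCast]
  have hn' : ((Algebra.norm ℤ β : ℤ) : K) = algebraMap ℚ K (u ^ 2 + N * v ^ 2) := by
    rw [← hn, ← Algebra.coe_norm_int, map_intCast]
  simp only [map_sub, map_mul, map_pow, map_intCast]
  rw [ht', hn', show algebraMap (𝓞 K) K β = _ from hz]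
  simp only [map_mul, map_add, map_pow, map_ofNat]
  linear_combination (algebraMap ℚ K v) ^ 2 * hx

theorem trace_sq_le_four_mul_norm_of_sq_eq_neg (hdeg : Module.finrank ℚ K = 2) (hN : 0 < N)
    (hx : x ^ 2 = -algebraMap ℚ K N) (β : 𝓞 K) :
    Algebra.trace ℤ (𝓞 K) β ^ 2 ≤ 4 * Algebra.norm ℤ β := by
  obtain ⟨u, v, -, ht, hn⟩ := exists_trace_eq_and_norm_eq_of_sq_eq_neg hdeg hN hx (β : K)
  rw [← Algebra.coe_trace_int] at ht
  rw [← Algebra.coe_norm_int] at hn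
  have : 0 ≤ N * v ^ 2 := by positivity
  have : (Algebra.trace ℤ (𝓞 K) β ^ 2 : ℚ) ≤ 4 * Algebra.norm ℤ β := by
    rw [ht, hn]
    linarith
  exact_mod_cast this

theorem trace_mul_sq_sub_of_sq_eq_neg (hdeg : Module.finrank ℚ K = 2) (hN : 0 < N)
    (hx : x ^ 2 = -algebraMap ℚ K N) (β γ : 𝓞 K) :
    Algebra.trace ℤ (𝓞 K) (β * γ) ^ 2 -
        Algebra.trace ℤ (𝓞 K) β * Algebra.trace ℤ (𝓞 K) γ * Algebra.trace ℤ (𝓞 K) (β * γ) +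
        Algebra.trace ℤ (𝓞 K) β ^ 2 * Algebra.norm ℤ γ +
        Algebra.trace ℤ (𝓞 K) γ ^ 2 * Algebra.norm ℤ β =
      4 * Algebra.norm ℤ β * Algebra.norm ℤ γ := by
  obtain ⟨u, v, hz, ht, hn⟩ := exists_trace_eq_and_norm_eq_of_sq_eq_neg hdeg hN hx (β : K)
  obtain ⟨u', v', hz', ht', hn'⟩ := exists_trace_eq_and_norm_eq_of_sq_eq_neg hdeg hN hx (γ : K)
  have hmul : Algebra.trace ℚ K ((β * γ : 𝓞 K) : K) = 2 * (u * u' - N * v * v') := by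
    have : ((β * γ : 𝓞 K) : K) = algebraMap ℚ K (u * u' - N * v * v') +
        algebraMap ℚ K (u * v' + v * u') * x := by
      rw [show ((β * γ : 𝓞 K) : K) = β * γ from map_mul _ _ _, hz, hz']
      simp only [map_mul, map_add, map_sub]
      linear_combination (algebraMap ℚ K v) * (algebraMap ℚ K v') * hx
    rw [this]
    exact (trace_and_norm_add_mul_of_sq_eq_neg hdeg hN hx _ _).1
  rw [← Algebra.coe_trace_int] at ht ht' hmul
  rw [← Algebra.coe_norm_int] at hn hn'
  have : (Algebra.trace ℤ (𝓞 K) (β * γ) ^ 2 -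
        Algebra.trace ℤ (𝓞 K) β * Algebra.trace ℤ (𝓞 K) γ * Algebra.trace ℤ (𝓞 K) (β * γ) +
        Algebra.trace ℤ (𝓞 K) β ^ 2 * Algebra.norm ℤ γ +
        Algebra.trace ℤ (𝓞 K) γ ^ 2 * Algebra.norm ℤ β : ℚ) =
      4 * Algebra.norm ℤ β * Algebra.norm ℤ γ := by
    rw [ht, ht', hmul, hn, hn']
    ring
  exact_mod_cast this

end NumberField.RingOfIntegers

section LucasSequence

variable {V : ℕ → ℤ} {t P : ℤ}

theorem dvd_lucas_of_odd (h1 : V 1 = t) (h : ∀ k, V (k + 2) = t * V (k + 1) - P * V k) {k : ℕ}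
    (hk : Odd k) : t ∣ V k := by
  obtain ⟨k, rfl⟩ := hk
  induction k with
  | zero => simp [h1]
  | succ k ih =>
    rw [show 2 * (k + 1) + 1 = 2 * k + 1 + 2 by ring, h]
    exact dvd_sub (dvd_mul_right _ _) (ih.mul_left _)

theorem three_dvd_of_even_lucas (h0 : V 0 = 2) (h1 : V 1 = t)
    (h : ∀ k, V (k + 2) = t * V (k + 1) - P * V k) (ht : Odd t) (hP : Odd P) {k : ℕ}
    (hk : Even (V k)) : 3 ∣ k := by
  have key : ∀ m, Even (V (3 * m)) ∧ Odd (V (3 * m + 1)) := by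
    intro m
    induction m with
    | zero => simp [h0, h1, ht]
    | succ m ih =>
      have h2 : Odd (V (3 * m + 2)) := by
        rw [h]
        exact (ht.mul ih.2).sub_even (ih.1.mul_left _)
      have h3 : Even (V (3 * m + 3)) := by
        rw [h (3 * m + 1)]
        exact (ht.mul h2).sub_odd (hP.mul ih.2)
      refine ⟨h3, ?_⟩
      rw [show 3 * (m + 1) + 1 = 3 * m + 2 + 2 by ring, h]
      exact (h3.mul_left _).sub_odd (hP.mul h2)
  have hkey := key (k / 3)
  have h2 : Odd (V (3 * (k / 3) + 2)) := by
    rw [h]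
    exact (ht.mul hkey.2).sub_even (hkey.1.mul_left _)
  have hr : k % 3 = 0 ∨ k % 3 = 1 ∨ k % 3 = 2 := by lia
  rcases hr with hr | hr | hr
  · exact Nat.dvd_of_mod_eq_zero hr
  · rw [show k = 3 * (k / 3) + 1 by lia] at hk
    exact absurd hk (Int.not_even_iff_odd.2 hkey.2)
  · rw [show k = 3 * (k / 3) + 2 by lia] at hk
    exact absurd hk (Int.not_even_iff_odd.2 h2)

end LucasSequence

namespace NumberField.RingOfIntegers

variable {K : Type*} [Field K] [NumberField K] {x : K} {N : ℚ}

theorem trace_intCast_of_finrank_eq_two (hdeg : Module.finrank ℚ K = 2) (m : ℤ) :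
    Algebra.trace ℤ (𝓞 K) m = 2 * m := by
  rw [← eq_intCast (algebraMap ℤ (𝓞 K)), Algebra.trace_algebraMap, RingOfIntegers.rank, hdeg]
  simp

theorem norm_eq_three_and_eq_five_of_trace_pow_eq_two (hdeg : Module.finrank ℚ K = 2)
    (hN : 0 < N) (hx : x ^ 2 = -algebraMap ℚ K N) {β : 𝓞 K} {P q : ℕ} (hq : q.Prime)
    (hqodd : Odd q) (hP : Odd P) (hP3 : 3 ≤ P) (hβ : Algebra.norm ℤ β = P)
    (htr : Algebra.trace ℤ (𝓞 K) (β ^ q) = 2) : P = 3 ∧ q = 5 := by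
  have hquad := sq_eq_trace_mul_sub_norm_of_sq_eq_neg hdeg hN hx β
  have htrI := trace_intCast_of_finrank_eq_two (K := K) hdeg
  rw [hβ] at hquad
  set s := Algebra.trace ℤ (𝓞 K) β with hs
  let V : ℕ → ℤ := fun k ↦ Algebra.trace ℤ (𝓞 K) (β ^ k)
  have hV0 : V 0 = 2 := by simpa [V] using htrI 1
  have hV1 : V 1 = s := by simp [V, hs]
  have hV : ∀ k, V (k + 2) = s * V (k + 1) - P * V k := by
    intro k
    have : β ^ (k + 2) = (s : 𝓞 K) * β ^ (k + 1) - ((P : ℤ) : 𝓞 K) * β ^ k := by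
      linear_combination β ^ k * hquad
    simp only [V]
    rw [this, map_sub, trace_intCast_mul, trace_intCast_mul]
  have hVq : V q = 2 := htr
  have hs2 : s ∣ 2 := hVq ▸ dvd_lucas_of_odd hV1 hV hqodd
  have hcases : s = 1 ∨ s = -1 ∨ ∃ a : ℤ, s = 2 * a ∧ (a = 1 ∨ a = -1) := by
    have h1 := Int.le_of_dvd (by norm_num) hs2
    have h2 := Int.le_of_dvd (by norm_num) (neg_dvd.2 hs2)
    have h0 : s ≠ 0 := by rintro h; rw [h] at hs2; norm_num at hs2
    have : s = 1 ∨ s = -1 ∨ s = 2 ∨ s = -2 := by lia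
    rcases this with h | h | h | h
    · exact Or.inl h
    · exact Or.inr (Or.inl h)
    · exact Or.inr (Or.inr ⟨1, h, Or.inl rfl⟩)
    · exact Or.inr (Or.inr ⟨-1, by lia, Or.inr rfl⟩)
  have hodd : Odd s → False := by
    intro hsodd
    have h3 : 3 ∣ q := three_dvd_of_even_lucas hV0 hV1 hV hsodd (by exact_mod_cast hP)
      (by rw [hVq]; exact even_two)
    obtain rfl : 3 = q := (Nat.prime_dvd_prime_iff_eq Nat.prime_three hq).1 h3
    rw [hV 1, hV 0, hV0, zero_add, hV1] at hVq
    rcases hcases with h | h | ⟨a, h, -⟩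
    · rw [h] at hVq; lia
    · rw [h] at hVq; lia
    · rw [h] at hsodd
      exact Int.not_odd_iff_even.2 (even_two_mul a) hsodd
  rcases hcases with h | h | ⟨a, h, ha⟩
  · exact (hodd (h ▸ odd_one)).elim
  · exact (hodd (h ▸ by decide)).elim
  have ha2 : a ^ 2 = 1 := by rcases ha with rfl | rfl <;> norm_num
  have ha2' : (a : 𝓞 K) ^ 2 = 1 := by exact_mod_cast congrArg (Int.cast (R := 𝓞 K)) ha2
  rw [h] at hquad
  push_cast at hquad
  let f : ℤ√(1 - P) →+* 𝓞 K := Zsqrtd.lift ⟨(a : 𝓞 K) * β - 1, by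
    push_cast
    linear_combination (a : 𝓞 K) ^ 2 * hquad + (2 * a * β - P) * ha2'⟩
  have hf : ∀ z, Algebra.trace ℤ (𝓞 K) (f z) = 2 * z.re := by
    intro z
    have : f z = (z.re : 𝓞 K) + (z.im : 𝓞 K) * ((a : 𝓞 K) * β - ((1 : ℤ) : 𝓞 K)) := by
      simp [f, Zsqrtd.lift]
    rw [this, map_add, htrI, trace_intCast_mul, map_sub, trace_intCast_mul, htrI, ← hs, h]
    linear_combination 2 * z.im * ha2
  have hfq : f ((1 + Zsqrtd.sqrtd) ^ q) = ((a ^ q : ℤ) : 𝓞 K) * β ^ q := by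
    have : f Zsqrtd.sqrtd = (a : 𝓞 K) * β - 1 := by simp [f, Zsqrtd.lift]
    rw [map_pow, map_add, map_one, this, add_sub_cancel, mul_pow, Int.cast_pow]
  have hre : ((1 + Zsqrtd.sqrtd : ℤ√(1 - P)) ^ q).re = a ^ q := by
    have := hf ((1 + Zsqrtd.sqrtd) ^ q)
    rw [hfq, trace_intCast_mul, htr] at this
    linarith
  refine Zsqrtd.eq_three_and_eq_five_of_re_one_add_sqrtd_pow hP hP3 hqodd hq.ne_one ?_
  rw [hre]
  rcases ha with rfl | rfl
  · simp
  · simp [hqodd.neg_one_pow]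

theorem norm_eq_three_and_eq_five_of_trace_unit_mul_pow_eq_two
    (hdeg : Module.finrank ℚ K = 2) (hN : 0 < N) (hx : x ^ 2 = -algebraMap ℚ K N)
    {w β : 𝓞 K} (hw : IsUnit w) {P q : ℕ} (hq : q.Prime)
    (hqodd : Odd q) (hP : Odd P) (hP3 : 3 ≤ P) (hβ : Algebra.norm ℤ β = P)
    (htr : Algebra.trace ℤ (𝓞 K) (w * β ^ q) = 2) : P = 3 ∧ q = 5 := by
  have hwsq := trace_sq_le_four_mul_norm_of_sq_eq_neg hdeg hN hx w
  have hwnorm : Algebra.norm ℤ w = 1 := by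
    have := Int.isUnit_iff.1 (hw.map (Algebra.norm ℤ))
    rcases this with h | h
    · exact h
    · rw [h] at hwsq
      nlinarith [sq_nonneg (Algebra.trace ℤ (𝓞 K) w)]
  have hwquad := sq_eq_trace_mul_sub_norm_of_sq_eq_neg hdeg hN hx w
  have hfricke := trace_mul_sq_sub_of_sq_eq_neg hdeg hN hx w β
  have hquad := sq_eq_trace_mul_sub_norm_of_sq_eq_neg hdeg hN hx β
  rw [hwnorm] at hwsq hwquad hfricke
  rw [hβ] at hquad hfricke
  set t := Algebra.trace ℤ (𝓞 K) w with ht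
  have hroot : ∀ j : ℕ, (w ^ j) ^ q = w → P = 3 ∧ q = 5 := fun j hj ↦ by
    refine norm_eq_three_and_eq_five_of_trace_pow_eq_two hdeg hN hx (β := w ^ j * β) hq hqodd hP
      hP3 ?_ ?_
    · rw [map_mul, map_pow, hwnorm, one_pow, one_mul, hβ]
    · rw [mul_pow, hj, htr]
  have hcases : t ^ 2 = 1 ∧ w ^ 6 = 1 ∨ w ^ 4 = 1 := by
    have h1 : t ≤ 2 := by nlinarith
    have h2 : -2 ≤ t := by nlinarith
    push_cast at hwquad
    have : t = -2 ∨ t = -1 ∨ t = 0 ∨ t = 1 ∨ t = 2 := by lia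
    rcases this with h | h | h | h | h <;> rw [h] at hwquad ⊢ <;> push_cast at hwquad
    · have : w + 1 = 0 := pow_eq_zero_iff two_ne_zero |>.1 (by linear_combination hwquad)
      rw [eq_neg_of_add_eq_zero_left this]
      norm_num
    · refine Or.inl ⟨by norm_num, ?_⟩
      linear_combination (w ^ 4 - w ^ 3 + w - 1) * hwquad
    · refine Or.inr ?_
      linear_combination (w ^ 2 - 1) * hwquad
    · refine Or.inl ⟨by norm_num, ?_⟩
      linear_combination (w ^ 4 + w ^ 3 - w - 1) * hwquad
    · have : w - 1 = 0 := pow_eq_zero_iff two_ne_zero |>.1 (by linear_combination hwquad)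
      rw [sub_eq_zero.1 this]
      norm_num
  by_cases hq3 : q = 3
  · subst hq3
    rcases hcases with ⟨ht2, -⟩ | hw4
    · exfalso
      set s := Algebra.trace ℤ (𝓞 K) β
      set τ := Algebra.trace ℤ (𝓞 K) (w * β)
      have hcube : w * β ^ 3 = ((s ^ 2 - P : ℤ) : 𝓞 K) * (w * β) - ((s * P : ℤ) : 𝓞 K) * w := by
        push_cast at hquad ⊢
        linear_combination w * (β + s) * hquad
      rw [hcube, map_sub, trace_intCast_mul, trace_intCast_mul, ← ht] at htr
      have hPodd : ¬ Even (P : ℤ) := by exact_mod_cast Nat.not_even_iff_odd.2 hP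
      have htodd : ¬ Even t := fun h ↦ by
        have := h.pow_of_ne_zero two_ne_zero
        rw [ht2] at this
        exact absurd this (by decide)
      have h1 : Even ((s ^ 2 - P) * τ - s * P * t) := htr ▸ even_two
      have h2 : Even (τ ^ 2 - t * s * τ + t ^ 2 * P + s ^ 2 * 1) := by
        rw [hfricke]
        exact ⟨2 * P, by ring⟩
      simp only [Int.even_add, Int.even_sub, Int.even_mul, Int.even_pow, hPodd, htodd] at h1 h2
      tauto
    · exact hroot 3 (by linear_combination (w ^ 5 + w) * hw4)
  · have hw12 : w ^ 12 = 1 := by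
      rcases hcases with ⟨-, h⟩ | h
      · linear_combination (w ^ 6 + 1) * h
      · linear_combination (w ^ 8 + w ^ 4 + 1) * h
    have hq12 : q * q % 12 = 1 := by
      have h3 : ¬ 3 ∣ q := fun h ↦ hq3 ((Nat.prime_dvd_prime_iff_eq Nat.prime_three hq).1 h).symm
      have h2 := Nat.odd_iff.1 hqodd
      have : q % 12 = 1 ∨ q % 12 = 5 ∨ q % 12 = 7 ∨ q % 12 = 11 := by lia
      rcases this with h | h | h | h <;> simp [Nat.mul_mod, h]
    refine hroot q ?_
    rw [← pow_mul, ← Nat.div_add_mod (q * q) 12, hq12, pow_add, pow_mul, hw12, one_pow, one_mul,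
      pow_one]

end NumberField.RingOfIntegers

/-- **Theorem 4.**  For any positive odd integer `n` and any odd prime `p` with
`(p, n) ≠ (3, 5)` and `pⁿ > 1`, the class number of the imaginary quadratic field
`ℚ(√(1 − pⁿ))` (formalized as any number field of degree 2 over `ℚ` containing a square root
of `1 − pⁿ`) is divisible by `n`. -/
theorem class_number_divisibility_one_minus_p_pow
    (n : ℕ) (hn : 0 < n) (hnodd : Odd n)
    (p : ℕ) (hp : p.Prime) (hpodd : Odd p)
    (hexc : ¬ (p = 3 ∧ n = 5)) (hgt : 1 < (p : ℤ) ^ n)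
    (K : Type) [Field K] [NumberField K]
    (x : K) (hx : x ^ 2 = ((1 - (p : ℤ) ^ n : ℤ) : K)) (hdeg : Module.finrank ℚ K = 2) :
    n ∣ classNumber K := by
  have hN : (0 : ℚ) < p ^ n - 1 := sub_pos.2 (by exact_mod_cast hgt)
  have hxN : x ^ 2 = -algebraMap ℚ K (p ^ n - 1) := by
    rw [hx]
    simp
  have hint : IsIntegral ℤ x := IsIntegral.of_pow two_pos (hx ▸ isIntegral_algebraMap)
  obtain ⟨y, rfl⟩ : ∃ y : 𝓞 K, (y : K) = x := ⟨⟨x, hint⟩, rfl⟩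
  have hy : y ^ 2 = 1 - (p : 𝓞 K) ^ n := by
    apply RingOfIntegers.coe_injective
    simpa using hx
  have htn := trace_and_norm_add_mul_of_sq_eq_neg hdeg hN hxN 1 1
  have hcast : algebraMap ℚ K 1 + algebraMap ℚ K 1 * (y : K) = ((1 + y : 𝓞 K) : K) := by simp
  rw [hcast, ← Algebra.coe_trace_int, ← Algebra.coe_norm_int] at htn
  have htr : Algebra.trace ℤ (𝓞 K) (1 + y) = 2 := by
    exact_mod_cast htn.1.trans (mul_one 2)
  have hnorm : Algebra.norm ℤ (1 + y) = (p : ℤ) ^ n := by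
    have : (Algebra.norm ℤ (1 + y) : ℚ) = (p : ℚ) ^ n := by rw [htn.2]; ring
    exact_mod_cast this
  have hcop : IsCoprime (Ideal.span {1 + y}) (Ideal.span {1 - y}) := by
    rw [Ideal.isCoprime_span_singleton_iff]
    obtain ⟨m, hm⟩ := hpodd.pow (n := n)
    have hm' : (p : 𝓞 K) ^ n = 2 * m + 1 := by exact_mod_cast congrArg (Nat.cast (R := 𝓞 K)) hm
    exact ⟨1 - y - m, -m, by linear_combination hm' - hy⟩
  have hprod : Ideal.span {1 + y} * Ideal.span {1 - y} = Ideal.span {(p : 𝓞 K)} ^ n := by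
    rw [Ideal.span_singleton_mul_span_singleton, Ideal.span_singleton_pow]
    congr 2
    linear_combination -hy
  obtain ⟨I, hI⟩ := exists_eq_pow_of_mul_eq_pow_of_coprime hcop hprod
  have hInorm : Ideal.absNorm I = p := by
    have := congrArg Ideal.absNorm hI
    rw [Ideal.absNorm_span_singleton, hnorm, map_pow, Int.natAbs_pow, Int.natAbs_natCast] at this
    exact (Nat.pow_left_injective hn.ne' this).symm
  have hI0 : I ∈ nonZeroDivisors (Ideal (𝓞 K)) := by
    rw [mem_nonZeroDivisors_iff_ne_zero]
    rintro rfl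
    exact hp.ne_zero (by simpa using hInorm.symm)
  have hpow : ∀ k, ClassGroup.mk0 ⟨I, hI0⟩ ^ k = 1 ↔ (I ^ k).IsPrincipal := by
    intro k
    rw [← map_pow, ClassGroup.mk0_eq_one_iff]
    rfl
  have horder : orderOf (ClassGroup.mk0 ⟨I, hI0⟩) = n := by
    refine orderOf_eq_of_pow_and_pow_div_prime hn ((hpow n).2 (hI ▸ ⟨⟨_, rfl⟩⟩)) ?_
    rintro q hq ⟨k, rfl⟩ h
    rw [Nat.mul_div_cancel_left _ hq.pos, hpow] at h
    obtain ⟨β, hβ⟩ := h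
    rw [← Ideal.span] at hβ
    have hβnorm : Algebra.norm ℤ β = (p ^ k : ℕ) := by
      have h1 := congrArg Ideal.absNorm hβ
      rw [map_pow, hInorm, Ideal.absNorm_span_singleton] at h1
      have h2 := RingOfIntegers.trace_sq_le_four_mul_norm_of_sq_eq_neg hdeg hN hxN β
      have h3 := sq_nonneg (Algebra.trace ℤ (𝓞 K) β)
      lia
    obtain ⟨w, hw⟩ : Associated (β ^ q) (1 + y) := by
      rw [← Ideal.span_singleton_eq_span_singleton, ← Ideal.span_singleton_pow, ← hβ, hI,
        ← pow_mul, mul_comm]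
    have hk : k ≠ 0 := by rintro rfl; simp at hn
    have hP : Odd (p ^ k) := hpodd.pow
    have hp3 : 3 ≤ p ^ k := by
      have := Nat.one_lt_pow hk hp.one_lt
      have := Nat.odd_iff.1 hP
      lia
    rw [mul_comm] at hw
    obtain ⟨h3, rfl⟩ := RingOfIntegers.norm_eq_three_and_eq_five_of_trace_unit_mul_pow_eq_two
      hdeg hN hxN w.isUnit hq (Nat.odd_mul.1 hnodd).1 hP hp3 hβnorm (hw ▸ htr)
    have hk1 : k = 1 := Nat.Prime.eq_one_of_pow (h3 ▸ Nat.prime_three)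
    subst hk1
    exact hexc ⟨by simpa using h3, rfl⟩
  rw [← horder, classNumber]
  exact orderOf_dvd_card
end

section
/- Let n ≥ 3 be an odd integer, q an odd prime, and d < 0 a fixed square-free integer. Then there are only finitely many primes p for which there exists a positive integer m with q² − pⁿ = m²d. -/
section

open Polynomial Finset

/-- The product of the differences of `i` with the other elements of `{0, …, k}`. -/
lemma prod_range_erase_sub (i k : ℕ) (hik : i ≤ k) :
    ∏ j ∈ (range (k + 1)).erase i, ((i : ℚ) - j) = (-1) ^ (k - i) * (i.factorial * (k - i).factorial) := by
  induction k, hik using Nat.le_induction with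
  | base =>
    have h : (range (i + 1)).erase i = range i := by
      ext j; simp; omega
    rw [h, ← prod_range_reflect, ← Finset.prod_range_add_one_eq_factorial]
    simp only [Nat.sub_self, pow_zero, one_mul, Nat.factorial_zero, Nat.cast_one, mul_one]
    push_cast
    refine prod_congr rfl fun j hj => ?_
    have := mem_range.mp hj
    rw [Nat.cast_sub (by omega), Nat.cast_sub (by omega)]
    push_cast; ring
  | succ k hk ih =>
    have h : (range (k + 1 + 1)).erase i = insert (k + 1) ((range (k + 1)).erase i) := by
      ext j; simp; omega
    rw [h, prod_insert (by simp), ih, Nat.succ_sub hk, Nat.factorial_succ, Nat.succ_eq_add_one,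
      pow_succ]
    push_cast [Nat.cast_sub hk]
    ring

/-- A product of `k` terms of an arithmetic progression of difference `n` is divisible by `k!`
up to a factor `n ^ k`. -/
lemma factorial_dvd_pow_mul_prod (n k : ℕ) (a : ℤ) :
    (k.factorial : ℤ) ∣ n ^ k * ∏ j ∈ range k, (a - n * j) := by
  rw [Int.natCast_dvd, Nat.dvd_iff_prime_pow_dvd_dvd]
  intro p e hp hpe
  rw [← Int.natCast_dvd]
  by_cases hpn : p ∣ n
  · refine Dvd.dvd.mul_right ?_ _
    have he : e ≤ k := by
      have := Fact.mk hp
      rw [padicValNat_dvd_iff_le k.factorial_ne_zero] at hpe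
      have := sub_one_mul_padicValNat_factorial (p := p) k
      have h1 : padicValNat p k.factorial ≤ (p - 1) * padicValNat p k.factorial :=
        Nat.le_mul_of_pos_left _ (Nat.sub_pos_of_lt hp.one_lt)
      omega
    exact_mod_cast (pow_dvd_pow_of_dvd hpn e).trans (pow_dvd_pow n he)
  · refine Dvd.dvd.mul_left ?_ _
    have hcop : IsCoprime (n : ℤ) ((p ^ e : ℕ) : ℤ) :=
      Nat.isCoprime_iff_coprime.mpr (Nat.Coprime.pow_right e ((hp.coprime_iff_not_dvd.mpr hpn).symm))
    obtain ⟨b, c, hbc⟩ := hcop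
    set P : ℤ := ((p ^ e : ℕ) : ℤ) with hP
    have hP0 : 0 < P := Int.natCast_pos.mpr (pow_pos hp.pos e)
    obtain ⟨u, hu⟩ := Int.eq_ofNat_of_zero_le (Int.emod_nonneg (a * b) hP0.ne')
    have hcong : a ≡ n * u [ZMOD P] := by
      rw [← hu]
      have h1 : (n : ℤ) * (a * b % P) ≡ n * (a * b) [ZMOD P] := (Int.mod_modEq _ _).mul_left _
      refine (h1.trans ?_).symm
      rw [Int.modEq_iff_dvd]
      exact ⟨a * c, by linear_combination (-a) * hbc⟩
    have h2 : ∏ j ∈ range k, (a - n * j) ≡ ∏ j ∈ range k, ((n : ℤ) * (u - j)) [ZMOD P] := by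
      refine Int.ModEq.prod fun j _ => ?_
      rw [mul_sub]
      exact hcong.sub_right _
    rw [Int.ModEq.dvd_iff h2, prod_mul_distrib]
    refine Dvd.dvd.mul_left ?_ _
    have h3 : ∏ j ∈ range k, ((u : ℤ) - j) = (u.descFactorial k : ℤ) := by
      rw [← descPochhammer_eval_eq_prod_range, descPochhammer_eval_eq_descFactorial]
    rw [h3, hP]
    exact_mod_cast hpe.trans (Nat.factorial_dvd_descFactorial u k)

lemma factorial_mul_le (n r : ℕ) : (n * r).factorial ≤ n ^ (n * r) * r.factorial ^ n := by
  induction r with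
  | zero => simp
  | succ r ih =>
    calc (n * (r + 1)).factorial = (n * r + n).factorial := by rw [mul_add, mul_one]
      _ = (n * r).factorial * (n * r + 1).ascFactorial n := (Nat.factorial_mul_ascFactorial _ _).symm
      _ ≤ (n ^ (n * r) * r.factorial ^ n) * (n * r + n) ^ n := by
        gcongr
        exact Nat.ascFactorial_le_pow_add _ _
      _ = _ := by
        rw [Nat.factorial_succ, mul_pow, show n * r + n = n * (r + 1) by ring, mul_pow n (r + 1) n,
          mul_add n r 1, pow_add, mul_one]
        ring

/-- The difference of two nodes, with the value `1` at coinciding nodes, so that products over all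
nodes ignore the coinciding one. -/
def nodeDiff (s u : ℕ) : ℚ := if u = s then 1 else (s : ℚ) - u

lemma prod_nodeDiff_range {s k : ℕ} (hs : s ≤ k) :
    ∏ u ∈ range (k + 1), nodeDiff s u = (-1) ^ (k - s) * (s.factorial * (k - s).factorial) := by
  rw [← prod_range_erase_sub s k hs, ← prod_erase (a := s) _ (by simp [nodeDiff])]
  exact prod_congr rfl fun u hu => if_neg (ne_of_mem_erase hu)

lemma prod_range_mul_eq (f : ℕ → ℚ) (n R : ℕ) :
    ∏ u ∈ range (n * R), f u = ∏ e ∈ range n, ∏ j ∈ range R, f (n * j + e) := by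
  rw [prod_comm]
  induction R with
  | zero => simp
  | succ R ih => rw [mul_add, mul_one, prod_range_add, ih, prod_range_succ]

lemma nodeDiff_ne_zero (s u : ℕ) : nodeDiff s u ≠ 0 := by
  unfold nodeDiff
  split_ifs with h
  · exact one_ne_zero
  · exact sub_ne_zero.mpr fun h' => h (by exact_mod_cast h'.symm)

lemma le_abs_prod_nodeDiff {n i r e e' : ℕ} (hn : 2 ≤ n) (hi : i ≤ r) (he : e < 2) (he' : e' < 2) :
    ((i.factorial * (r - i).factorial : ℕ) : ℚ) ≤
      |∏ j ∈ range (r + 1), nodeDiff (n * i + e) (n * j + e')| := by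
  have h1 : ((i.factorial * (r - i).factorial : ℕ) : ℚ) =
      ∏ j ∈ range (r + 1), |nodeDiff i j| := by
    rw [← abs_prod, prod_nodeDiff_range hi, abs_mul, abs_pow, abs_neg, abs_one, one_pow, one_mul]
    push_cast
    exact (abs_of_nonneg (by positivity)).symm
  rw [h1, abs_prod]
  refine prod_le_prod (fun _ _ => abs_nonneg _) fun j _ => ?_
  have key : ∀ z : ℤ, z ≠ 0 → (1 : ℚ) ≤ |(z : ℚ)| := fun z hz => by
    exact_mod_cast Int.one_le_abs hz
  by_cases hij : j = i
  · have : |nodeDiff i j| = 1 := by simp [nodeDiff, hij]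
    rw [this]
    unfold nodeDiff
    split_ifs with h
    · simp
    · have := key ((n * i + e : ℕ) - (n * j + e' : ℕ)) (by omega)
      exact_mod_cast this
  · have hne : n * j + e' ≠ n * i + e := by
      intro h
      rcases lt_or_gt_of_ne hij with h' | h'
      · nlinarith [Nat.mul_le_mul_left n (Nat.succ_le_of_lt h')]
      · nlinarith [Nat.mul_le_mul_left n (Nat.succ_le_of_lt h')]
    rw [nodeDiff, if_neg hij, nodeDiff, if_neg hne]
    have hn' : (2 : ℚ) ≤ n := by exact_mod_cast hn
    have e0 : (e : ℚ) ≤ 1 := by exact_mod_cast Nat.le_of_lt_succ he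
    have e0' : (e' : ℚ) ≤ 1 := by exact_mod_cast Nat.le_of_lt_succ he'
    have e1 : (0 : ℚ) ≤ e := e.cast_nonneg
    have e1' : (0 : ℚ) ≤ e' := e'.cast_nonneg
    push_cast
    rcases lt_or_gt_of_ne hij with h' | h'
    · have h2 : (j : ℚ) + 1 ≤ i := by exact_mod_cast h'
      rw [abs_of_nonneg (by linarith)]
      refine le_trans ?_ (le_abs_self _)
      nlinarith
    · have h2 : (i : ℚ) + 1 ≤ j := by exact_mod_cast h'
      rw [abs_of_nonpos (by linarith)]
      refine le_trans ?_ (neg_le_abs _)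
      nlinarith

/-- A common denominator of the weights of the nodes `n * i + e`, `i ≤ r`, `e < 2`. -/
noncomputable def weightScale (n r : ℕ) : ℚ :=
  (n * (r + 1) - 1).factorial * ((n : ℚ) ^ (r + 1) / (r + 1).factorial) ^ (n - 2)

/-- The nodal weight of `n * i + e` among the nodes `n * j + e'`, `j ≤ r`, `e' < 2`, multiplied by
`weightScale n r`. -/
noncomputable def scaledWeight (n r i e : ℕ) : ℚ :=
  weightScale n r / ∏ e' ∈ range 2, ∏ j ∈ range (r + 1), nodeDiff (n * i + e) (n * j + e')

lemma exists_int_eq_scaledWeight {n r i e : ℕ} (hn : 2 ≤ n) (hi : i ≤ r) (he : e < 2) :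
    ∃ z : ℤ, (z : ℚ) = scaledWeight n r i e := by
  set s := n * i + e with hs
  set N := n * (r + 1) - 1 with hN
  have hnr : n * i ≤ n * r := Nat.mul_le_mul_left n hi
  have hN1 : N + 1 = n * (r + 1) := Nat.sub_add_cancel (by nlinarith)
  have hsN : s ≤ N := by rw [mul_add] at hN1; omega
  have hfull := prod_nodeDiff_range hsN
  rw [hN1, prod_range_mul_eq, ← prod_range_mul_prod_Ico _ hn] at hfull
  have hterm : ∀ e' ∈ Ico 2 n, ∃ z : ℤ, (z : ℚ) = (n : ℚ) ^ (r + 1) / (r + 1).factorial *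
      ∏ j ∈ range (r + 1), nodeDiff s (n * j + e') := by
    intro e' he'
    obtain ⟨h2, hlt⟩ := mem_Ico.mp he'
    obtain ⟨z, hz⟩ := factorial_dvd_pow_mul_prod n (r + 1) ((s : ℤ) - e')
    refine ⟨z, ?_⟩
    have hprod : ∏ j ∈ range (r + 1), nodeDiff s (n * j + e') =
        ∏ j ∈ range (r + 1), (((s : ℚ) - e') - n * j) := by
      refine prod_congr rfl fun j _ => ?_
      have hne : n * j + e' ≠ s := by
        intro h
        have h3 := congrArg (· % n) h
        simp only [hs, Nat.mul_add_mod] at h3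
        rw [Nat.mod_eq_of_lt hlt, Nat.mod_eq_of_lt (by omega)] at h3
        omega
      rw [nodeDiff, if_neg hne]
      push_cast; ring
    have hz' := congrArg (Int.cast : ℤ → ℚ) hz
    push_cast at hz'
    have hf : ((r + 1).factorial : ℚ) ≠ 0 := by exact_mod_cast (r + 1).factorial_ne_zero
    rw [hprod]
    field_simp
    rw [hz']; ring
  choose! z hz using hterm
  refine ⟨(-1) ^ (N - s) * (N.choose s * ∏ e' ∈ Ico 2 n, z e'), ?_⟩
  push_cast
  rw [prod_congr rfl hz, prod_mul_distrib, prod_const, Nat.card_Ico, scaledWeight, weightScale,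
    ← hN, ← hs]
  have hP0 : ∏ e' ∈ range 2, ∏ j ∈ range (r + 1), nodeDiff s (n * j + e') ≠ 0 :=
    prod_ne_zero_iff.mpr fun _ _ => prod_ne_zero_iff.mpr fun _ _ => nodeDiff_ne_zero _ _
  rw [eq_div_iff hP0]
  have hch : (N.factorial : ℚ) = N.choose s * (s.factorial * (N - s).factorial) := by
    rw [← Nat.choose_mul_factorial_mul_factorial hsN]; push_cast; ring
  have hsq : ((-1 : ℚ) ^ (N - s)) * (-1) ^ (N - s) = 1 := by
    rw [← mul_pow]; simp
  rw [hch]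
  linear_combination ((-1 : ℚ) ^ (N - s) * N.choose s *
    ((n : ℚ) ^ (r + 1) / (r + 1).factorial) ^ (n - 2)) * hfull +
    (N.choose s * (s.factorial * (N - s).factorial) *
    ((n : ℚ) ^ (r + 1) / (r + 1).factorial) ^ (n - 2)) * hsq

lemma abs_scaledWeight_le {n r i e : ℕ} (hn : 2 ≤ n) (hi : i ≤ r) (he : e < 2) :
    |scaledWeight n r i e| ≤ (16 * (n : ℚ) ^ (2 * n)) ^ (r + 1) := by
  have hR : (0 : ℚ) < (r + 1).factorial := by exact_mod_cast (r + 1).factorial_pos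
  have hM0 : 0 ≤ weightScale n r := by unfold weightScale; positivity
  set Q : ℚ := ((i.factorial * (r - i).factorial : ℕ) : ℚ) with hQ
  have hQ0 : 0 < Q := by
    rw [hQ]; exact_mod_cast mul_pos i.factorial_pos (r - i).factorial_pos
  have hden : Q ^ 2 ≤
      |∏ e' ∈ range 2, ∏ j ∈ range (r + 1), nodeDiff (n * i + e) (n * j + e')| := by
    rw [prod_range_succ, prod_range_one, abs_mul, sq]
    exact mul_le_mul (le_abs_prod_nodeDiff hn hi he (by norm_num))
      (le_abs_prod_nodeDiff hn hi he (by norm_num)) hQ0.le (abs_nonneg _)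
  have hQfac : ((r + 1).factorial : ℚ) ≤ 4 ^ (r + 1) * Q := by
    have h1 : r.factorial ≤ 2 ^ r * (i.factorial * (r - i).factorial) := by
      rw [← Nat.choose_mul_factorial_mul_factorial hi, mul_assoc]
      gcongr
      exact Nat.choose_le_two_pow _ _
    have h2 : r + 1 ≤ 2 ^ (r + 1) := Nat.lt_two_pow_self.le
    rw [hQ]
    calc ((r + 1).factorial : ℚ) = (((r + 1) * r.factorial : ℕ) : ℚ) := by
          rw [Nat.factorial_succ]
      _ ≤ ((2 ^ (r + 1) * (2 ^ (r + 1) * (i.factorial * (r - i).factorial)) : ℕ) : ℚ) := by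
          have h3 : 2 ^ r ≤ 2 ^ (r + 1) := Nat.pow_le_pow_right (by norm_num) (by omega)
          exact_mod_cast Nat.mul_le_mul h2 (h1.trans (Nat.mul_le_mul_right _ h3))
      _ = _ := by
          push_cast
          rw [show (4 : ℚ) = 2 * 2 by norm_num, mul_pow]; ring
  have hM : weightScale n r ≤ ((n : ℚ) ^ (2 * n)) ^ (r + 1) * ((r + 1).factorial : ℚ) ^ 2 := by
    have h1 : ((n * (r + 1) - 1).factorial : ℚ) ≤
        (n : ℚ) ^ (n * (r + 1)) * ((r + 1).factorial : ℚ) ^ n := by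
      exact_mod_cast (Nat.factorial_le (Nat.sub_le _ _)).trans (factorial_mul_le n (r + 1))
    have hn1 : (1 : ℚ) ≤ n := by exact_mod_cast (by omega : 1 ≤ n)
    obtain ⟨k, rfl⟩ : ∃ k, n = k + 2 := ⟨n - 2, by omega⟩
    unfold weightScale
    rw [Nat.add_sub_cancel]
    generalize ((k + 2 : ℕ) : ℚ) = x at *
    calc _ ≤ (x ^ ((k + 2) * (r + 1)) * ((r + 1).factorial : ℚ) ^ (k + 2)) *
          (x ^ (r + 1) / (r + 1).factorial) ^ k := by gcongr
      _ = x ^ ((k + 2) * (r + 1) + (r + 1) * k) * ((r + 1).factorial : ℚ) ^ 2 := by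
          rw [div_pow, pow_add, ← pow_mul x (r + 1) k]
          field_simp
          rw [← pow_add]
      _ ≤ x ^ (2 * (k + 2) * (r + 1)) * ((r + 1).factorial : ℚ) ^ 2 := by
          gcongr
          nlinarith
      _ = _ := by rw [← pow_mul]
  rw [scaledWeight, abs_div, abs_of_nonneg hM0]
  refine (div_le_div_of_nonneg_left hM0 (by positivity) hden).trans ?_
  rw [div_le_iff₀ (by positivity)]
  refine hM.trans ?_
  calc ((n : ℚ) ^ (2 * n)) ^ (r + 1) * ((r + 1).factorial : ℚ) ^ 2
      ≤ ((n : ℚ) ^ (2 * n)) ^ (r + 1) * (4 ^ (r + 1) * Q) ^ 2 := by gcongr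
    _ = _ := by
      rw [mul_pow 16, mul_pow _ Q, ← pow_mul 4, mul_comm (r + 1) 2, pow_mul 4]
      norm_num; ring

lemma scaledWeight_one_pos {n r i : ℕ} (hn : 2 ≤ n) : 0 < scaledWeight n r i 1 := by
  have hn0 : (0 : ℚ) < n := by exact_mod_cast (by omega : 0 < n)
  refine div_pos (by unfold weightScale; positivity) ?_
  rw [prod_comm]
  refine prod_pos fun j _ => ?_
  rw [prod_range_succ, prod_range_one]
  unfold nodeDiff
  have hn' : (2 : ℚ) ≤ n := by exact_mod_cast hn
  rcases lt_trichotomy j i with h | h | h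
  · have h1 : n * j + n ≤ n * i := Nat.mul_le_mul_left n (Nat.succ_le_of_lt h)
    have h2 : (n * j + n : ℚ) ≤ n * i := by exact_mod_cast h1
    rw [if_neg (by omega), if_neg (by omega)]
    push_cast
    apply mul_pos <;> linarith
  · subst h
    simp
  · have h1 : n * i + n ≤ n * j := Nat.mul_le_mul_left n (Nat.succ_le_of_lt h)
    have h2 : (n * i + n : ℚ) ≤ n * j := by exact_mod_cast h1
    rw [if_neg (by omega), if_neg (by omega)]
    push_cast
    apply mul_pos_of_neg_of_neg <;> linarith

lemma sum_scaledWeight_mul_eval {n r : ℕ} (hn : 2 ≤ n) {P : ℚ[X]} (hP : P.natDegree < 2 * (r + 1)) :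
    ∑ i ∈ range (r + 1), ∑ e ∈ range 2, scaledWeight n r i e * P.eval ((n * i + e : ℕ) : ℚ) =
      weightScale n r * P.coeff (2 * r + 1) := by
  let v : ℕ × ℕ → ℚ := fun t => ((n * t.1 + t.2 : ℕ) : ℚ)
  set S := range (r + 1) ×ˢ range 2 with hS
  have hcard : #S = 2 * (r + 1) := by simp [hS, mul_comm]
  have hnat : ∀ s ∈ S, ∀ t ∈ S, n * s.1 + s.2 = n * t.1 + t.2 → s = t := by
    rintro ⟨i, e⟩ hs ⟨j, f⟩ ht h
    simp only [hS, mem_product, mem_range] at hs ht h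
    have h2 : e = f := by
      have h3 := congrArg (· % n) h
      simp only [Nat.mul_add_mod] at h3
      rwa [Nat.mod_eq_of_lt (by omega), Nat.mod_eq_of_lt (by omega)] at h3
    subst h2
    have h4 : n * i = n * j := by omega
    rw [Nat.eq_of_mul_eq_mul_left (by omega) h4]
  have hinj : Set.InjOn v S := fun s hs t ht h => hnat s hs t ht (Nat.cast_injective (R := ℚ) h)
  have hdeg : P.degree < #S := by
    refine lt_of_le_of_lt degree_le_natDegree ?_
    rw [hcard]; exact_mod_cast hP
  have key := Lagrange.coeff_eq_sum hinj hdeg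
  rw [hcard, show 2 * (r + 1) - 1 = 2 * r + 1 by omega] at key
  rw [key, mul_sum, hS, sum_product]
  refine sum_congr rfl fun i hi => sum_congr rfl fun e he => ?_
  have hmem : (i, e) ∈ S := by rw [hS]; exact mem_product.mpr ⟨hi, he⟩
  have hprod : ∏ t ∈ S.erase (i, e), (v (i, e) - v t) =
      ∏ e' ∈ range 2, ∏ j ∈ range (r + 1), nodeDiff (n * i + e) (n * j + e') := by
    rw [prod_comm, ← prod_product', ← hS]
    symm
    rw [← prod_erase (s := S) (a := (i, e)) (by simp [nodeDiff])]
    symm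
    refine prod_congr rfl fun t ht => ?_
    have hne : n * t.1 + t.2 ≠ n * i + e := fun h =>
      ne_of_mem_erase ht (hnat _ (mem_of_mem_erase ht) _ hmem h)
    rw [nodeDiff, if_neg hne]
  rw [← hS, hprod, scaledWeight]
  ring

/-- Two polynomials of degree at most `r` with integral coefficients of size exponential in `r`,
whose quotient approximates an `n`-th root near `1`. -/
structure IsPadePair (n r : ℕ) (A B : ℤ[X]) : Prop where
  natDegree_left : A.natDegree ≤ r
  natDegree_right : B.natDegree ≤ r
  abs_coeff_left : ∀ k, |A.coeff k| ≤ (16 * (n : ℤ) ^ (2 * n)) ^ (r + 1)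
  abs_coeff_right : ∀ k, |B.coeff k| ≤ (16 * (n : ℤ) ^ (2 * n)) ^ (r + 1)
  order_eq : ∃ H : ℤ[X], H.eval 1 ≠ 0 ∧
    expand ℤ n A - X * expand ℤ n B = (X - C 1) ^ (2 * r + 1) * H
  eval_right : B.eval 1 ≠ 0

lemma exists_isPadePair {n : ℕ} (hn : 2 ≤ n) (r : ℕ) : ∃ A B : ℤ[X], IsPadePair n r A B := by
  have hex : ∀ i e, ∃ z : ℤ, i ≤ r → e < 2 → (z : ℚ) = scaledWeight n r i e := by
    intro i e
    by_cases h : i ≤ r ∧ e < 2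
    · obtain ⟨z, hz⟩ := exists_int_eq_scaledWeight hn h.1 h.2
      exact ⟨z, fun _ _ => hz⟩
    · exact ⟨0, fun h1 h2 => absurd ⟨h1, h2⟩ h⟩
  choose z hz using hex
  have hcoeff : ∀ e k, (∑ i ∈ range (r + 1), C (z i e) * X ^ i : ℤ[X]).coeff k =
      if k ≤ r then z k e else 0 := by
    intro e k
    simp [coeff_X_pow]
  have hdeg : ∀ e, (∑ i ∈ range (r + 1), C (z i e) * X ^ i : ℤ[X]).natDegree ≤ r := by
    intro e
    rw [natDegree_le_iff_coeff_eq_zero]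
    intro k hk
    rw [hcoeff, if_neg (by omega)]
  have hbound : ∀ e < 2, ∀ k, |(∑ i ∈ range (r + 1), C (z i e) * X ^ i : ℤ[X]).coeff k| ≤
      (16 * (n : ℤ) ^ (2 * n)) ^ (r + 1) := by
    intro e he k
    rw [hcoeff]
    split_ifs with h
    · have := abs_scaledWeight_le hn h he
      rw [← hz k e h he] at this
      exact_mod_cast this
    · rw [abs_zero]; positivity
  set G : ℤ[X] := ∑ i ∈ range (r + 1), ∑ e ∈ range 2, C (z i e) * X ^ (n * i + e) with hG
  have htaylor : ∀ k ≤ 2 * r + 1, k.factorial * ((taylor 1 G).coeff k : ℚ) =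
      weightScale n r * (descPochhammer ℚ k).coeff (2 * r + 1) := by
    intro k hk
    rw [← sum_scaledWeight_mul_eval hn (by rw [descPochhammer_natDegree]; omega), taylor_coeff, hG,
      map_sum, eval_finsetSum]
    push_cast
    rw [mul_sum]
    refine sum_congr rfl fun i hi => ?_
    rw [map_sum, eval_finsetSum]
    push_cast
    rw [mul_sum]
    refine sum_congr rfl fun e he => ?_
    rw [C_mul_X_pow_eq_monomial, hasseDeriv_monomial, eval_monomial, one_pow, mul_one,
      ← hz i e (Nat.lt_succ_iff.mp (mem_range.mp hi)) (mem_range.mp he)]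
    have := descPochhammer_eval_eq_descFactorial ℚ (n * i + e) k
    push_cast at this ⊢
    rw [this, Nat.descFactorial_eq_factorial_mul_choose]
    push_cast; ring
  have hGdvd : (X - C 1) ^ (2 * r + 1) ∣ G := by
    rw [X_sub_C_pow_dvd_iff, ← taylor_apply, X_pow_dvd_iff]
    intro k hk
    have h := htaylor k hk.le
    rw [coeff_eq_zero_of_natDegree_lt (p := descPochhammer ℚ k)
      (by rw [descPochhammer_natDegree]; omega), mul_zero] at h
    rcases mul_eq_zero.mp h with h | h
    · exact absurd h (by exact_mod_cast k.factorial_ne_zero)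
    · exact_mod_cast h
  obtain ⟨H, hH⟩ := hGdvd
  refine ⟨∑ i ∈ range (r + 1), C (z i 0) * X ^ i, -∑ i ∈ range (r + 1), C (z i 1) * X ^ i,
    hdeg 0, by rw [natDegree_neg]; exact hdeg 1, hbound 0 (by norm_num),
    fun k => by rw [coeff_neg, abs_neg]; exact hbound 1 (by norm_num) k, ⟨H, ?_, ?_⟩, ?_⟩
  · intro h0
    have h := htaylor (2 * r + 1) le_rfl
    have h1 : (descPochhammer ℚ (2 * r + 1)).coeff (2 * r + 1) = 1 := by
      have := monic_descPochhammer ℚ (2 * r + 1)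
      rwa [Monic, leadingCoeff, descPochhammer_natDegree] at this
    have h2 : (taylor 1 G).coeff (2 * r + 1) = 0 := by
      rw [hH, taylor_mul, taylor_pow, map_sub, taylor_X, taylor_C, add_sub_cancel_right]
      have := coeff_X_pow_mul (taylor (1 : ℤ) H) (2 * r + 1) 0
      rw [zero_add] at this
      rw [this, taylor_coeff_zero, h0]
    rw [h1, h2, Int.cast_zero, mul_zero, mul_one] at h
    have hM : 0 < weightScale n r := by
      have hn0 : (0 : ℚ) < n := by exact_mod_cast (by omega : 0 < n)
      unfold weightScale
      positivity
    exact hM.ne h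
  · rw [← hH, hG, map_neg, map_sum, map_sum, mul_neg, sub_neg_eq_add, mul_sum, ← sum_add_distrib]
    refine sum_congr rfl fun i _ => ?_
    rw [sum_range_succ, sum_range_one]
    simp only [map_mul, map_pow, expand_X, expand_C]
    ring
  · rw [eval_neg, neg_ne_zero, eval_finsetSum]
    have : (0 : ℤ) < ∑ i ∈ range (r + 1), z i 1 := by
      refine sum_pos (fun i hi => ?_) ⟨0, by simp⟩
      have h := scaledWeight_one_pos (r := r) (i := i) hn
      rw [← hz i 1 (Nat.lt_succ_iff.mp (mem_range.mp hi)) (by norm_num)] at h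
      exact_mod_cast h
    simpa using this.ne'

lemma eq_of_X_sub_C_pow_mul_eq {a b : ℕ} {P Q : ℤ[X]} (hP : P.eval 1 ≠ 0) (hQ : Q.eval 1 ≠ 0)
    (h : (X - C 1) ^ a * P = (X - C 1) ^ b * Q) : a = b := by
  have key : ∀ (c : ℕ) (R : ℤ[X]), R.eval 1 ≠ 0 →
      rootMultiplicity 1 ((X - C 1) ^ c * R) = c := by
    intro c R hR
    have hR0 : R ≠ 0 := by rintro rfl; simp at hR
    rw [rootMultiplicity_mul (mul_ne_zero (pow_ne_zero _ (X_sub_C_ne_zero 1)) hR0),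
      rootMultiplicity_X_sub_C_pow, rootMultiplicity_eq_zero hR, add_zero]
  rw [← key a P hP, h, key b Q hQ]

/-- Consecutive Padé pairs are independent away from `1`. -/
lemma IsPadePair.det_ne_zero {n r : ℕ} (hn : 2 ≤ n) {A B A' B' : ℤ[X]} (h : IsPadePair n r A B)
    (h' : IsPadePair n (r + 1) A' B') {t : ℂ} (ht : t ≠ 1) :
    aeval t A * aeval t B' - aeval t A' * aeval t B ≠ 0 := by
  obtain ⟨H, hH1, hH⟩ := h.order_eq
  obtain ⟨H', -, hH'⟩ := h'.order_eq
  set W : ℤ[X] := A * B' - A' * B with hW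
  have hexp : expand ℤ n W = (X - C 1) ^ (2 * r + 1) *
      (H * expand ℤ n B' - (X - C 1) ^ 2 * H' * expand ℤ n B) := by
    rw [hW, map_sub, map_mul, map_mul]
    linear_combination expand ℤ n B' * hH - expand ℤ n B * hH'
  have heval : (H * expand ℤ n B' - (X - C 1) ^ 2 * H' * expand ℤ n B).eval 1 ≠ 0 := by
    simp only [eval_sub, eval_mul, eval_pow, eval_X, eval_C, expand_eval, one_pow, sub_self]
    simpa using ⟨hH1, h'.eval_right⟩
  have hW0 : W ≠ 0 := by
    intro h0
    rw [h0, map_zero] at hexp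
    rcases mul_eq_zero.mp hexp.symm with h1 | h1
    · exact pow_ne_zero _ (X_sub_C_ne_zero (1 : ℤ)) h1
    · exact heval (by rw [h1, eval_zero])
  obtain ⟨V, hV, hVdvd⟩ := exists_eq_pow_rootMultiplicity_mul_and_not_dvd W hW0 1
  have hV1 : V.eval 1 ≠ 0 := fun h0 => hVdvd (dvd_iff_isRoot.mpr h0)
  have hk : rootMultiplicity 1 W = 2 * r + 1 := by
    refine eq_of_X_sub_C_pow_mul_eq
      (P := (∑ i ∈ range n, X ^ i) ^ rootMultiplicity 1 W * expand ℤ n V) ?_ heval ?_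
    · have : n ≠ 0 := by omega
      simp [eval_finsetSum, expand_eval, hV1, this]
    · rw [← hexp]
      conv_rhs => rw [hV]
      rw [map_mul, map_pow, map_sub, expand_X, expand_C, ← mul_assoc, ← mul_pow, C_1, mul_geom_sum]
  rw [hk] at hV
  have hV0 : V ≠ 0 := by rintro rfl; simp at hV1
  have hVdeg : V.natDegree = 0 := by
    have h1 : W.natDegree ≤ 2 * r + 1 := by
      refine (natDegree_sub_le (A * B') (A' * B)).trans
        (max_le (natDegree_mul_le.trans ?_) (natDegree_mul_le.trans ?_))
      · have := h.natDegree_left; have := h'.natDegree_right; omega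
      · have := h.natDegree_right; have := h'.natDegree_left; omega
    rw [hV, natDegree_mul (pow_ne_zero _ (X_sub_C_ne_zero 1)) hV0, natDegree_pow,
      natDegree_X_sub_C] at h1
    omega
  rw [eq_C_of_natDegree_eq_zero hVdeg] at hV hV0
  have hmap := congrArg (aeval t) hV
  rw [hW] at hmap
  simp only [map_sub, map_mul, map_pow, aeval_X, aeval_C] at hmap
  rw [hmap]
  refine mul_ne_zero (pow_ne_zero _ ?_) ?_
  · simpa [sub_eq_zero] using ht
  · have : V.coeff 0 ≠ 0 := fun h0 => hV0 (by rw [h0, C_0])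
    simpa using this

lemma norm_aeval_le_of_dvd {G : ℤ[X]} {N m : ℕ} {L : ℝ} (hN : G.natDegree ≤ N)
    (hL : ∀ k, |(G.coeff k : ℝ)| ≤ L) (hdvd : (X - C 1) ^ m ∣ G) {y : ℂ} (hy : ‖y - 1‖ ≤ 1) :
    ‖aeval y G‖ ≤ (N + 1) * 2 ^ N * L * ‖y - 1‖ ^ m := by
  have hL0 : 0 ≤ L := (abs_nonneg _).trans (hL 0)
  have h1 : aeval y G = ∑ k ∈ range (N + 1), ((taylor 1 G).coeff k : ℂ) * (y - 1) ^ k := by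
    have h2 : aeval y G = aeval (y - 1) (taylor 1 G) := by
      rw [taylor_apply, aeval_comp]; simp
    rw [h2, aeval_eq_sum_range' (n := N + 1) (by rw [natDegree_taylor]; omega)]
    simp
  have hcoef : ∀ k, ‖((taylor 1 G).coeff k : ℂ)‖ ≤ ∑ s ∈ range (N + 1), L * (s.choose k : ℝ) := by
    intro k
    have h2 : (taylor 1 G).coeff k = ∑ s ∈ range (N + 1), (s.choose k : ℤ) * G.coeff s := by
      rw [taylor_coeff, hasseDeriv_apply,
        sum_over_range' G (by simp) (N + 1) (by omega), eval_finsetSum]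
      simp
    rw [h2, Int.cast_sum]
    refine (norm_sum_le _ _).trans (sum_le_sum fun s _ => ?_)
    rw [Int.cast_mul, norm_mul, Complex.norm_intCast, Complex.norm_intCast, mul_comm]
    have := hL s
    gcongr
    simp
  have hterm : ∀ k ∈ range (N + 1), ‖((taylor 1 G).coeff k : ℂ) * (y - 1) ^ k‖ ≤
      (∑ s ∈ range (N + 1), L * (s.choose k : ℝ)) * ‖y - 1‖ ^ m := by
    intro k _
    rw [X_sub_C_pow_dvd_iff, ← taylor_apply, X_pow_dvd_iff] at hdvd
    rw [norm_mul, norm_pow]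
    rcases lt_or_ge k m with hk | hk
    · rw [hdvd k hk]; simp; positivity
    · exact mul_le_mul (hcoef k) (pow_le_pow_of_le_one (norm_nonneg _) hy hk) (by positivity)
        (by positivity)
  rw [h1]
  refine (norm_sum_le_of_le _ hterm).trans ?_
  rw [← sum_mul, sum_comm]
  gcongr
  calc ∑ s ∈ range (N + 1), ∑ k ∈ range (N + 1), L * (s.choose k : ℝ)
      ≤ ∑ s ∈ range (N + 1), L * 2 ^ N := by
        refine sum_le_sum fun s hs => ?_
        rw [← mul_sum]
        gcongr
        have hs' : s ≤ N := Nat.lt_succ_iff.mp (mem_range.mp hs)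
        have h2 : ∑ k ∈ range (N + 1), s.choose k = 2 ^ s := by
          rw [← Nat.sum_range_choose]
          refine (sum_subset (range_subset_range.mpr (by omega)) fun k _ hk => ?_).symm
          exact Nat.choose_eq_zero_of_lt (by simpa using hk)
        calc (∑ k ∈ range (N + 1), (s.choose k : ℝ)) = 2 ^ s := by exact_mod_cast h2
          _ ≤ 2 ^ N := pow_le_pow_right₀ (by norm_num) hs'
    _ = _ := by rw [sum_const, card_range, nsmul_eq_mul]; push_cast; ring

lemma norm_pow_sub_pow_le_mul {a b : ℂ} (ha : ‖a‖ ≤ 1) (hb : ‖b‖ ≤ 1) (k : ℕ) :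
    ‖a ^ k - b ^ k‖ ≤ k * ‖a - b‖ := by
  induction k with
  | zero => simp
  | succ k ih =>
    have h : a ^ (k + 1) - b ^ (k + 1) = (a ^ k - b ^ k) * a + b ^ k * (a - b) := by ring
    rw [h]
    refine (norm_add_le _ _).trans ?_
    rw [norm_mul, norm_mul, norm_pow]
    have h1 : ‖b‖ ^ k ≤ 1 := pow_le_one₀ (norm_nonneg _) hb
    have h2 := mul_le_mul ih ha (norm_nonneg _) (by positivity)
    have h3 := mul_le_mul_of_nonneg_right h1 (norm_nonneg (a - b))
    push_cast
    linarith

lemma norm_sub_one_le_norm_pow_sub_one {n : ℕ} (hn : 2 ≤ n) {y : ℂ} (hy : ‖y‖ = 1)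
    (hy1 : ‖y - 1‖ ≤ 1 / (2 * n)) : ‖y - 1‖ ≤ ‖y ^ n - 1‖ := by
  have hn' : (2 : ℝ) ≤ n := by exact_mod_cast hn
  have hsum : ∑ i ∈ range n, y ^ i = n + ∑ i ∈ range n, (y ^ i - 1) := by simp
  have hsmall : ‖∑ i ∈ range n, (y ^ i - 1)‖ ≤ n * (1 / 2) := by
    refine (norm_sum_le_of_le (f := fun i => y ^ i - 1) (n := fun _ => 1 / 2) _
      fun i hi => ?_).trans (by simp)
    have h1 := norm_pow_sub_pow_le_mul hy.le (b := 1) (by simp) i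
    rw [one_pow] at h1
    have hi' : (i : ℝ) ≤ n := by exact_mod_cast (mem_range.mp hi).le
    refine h1.trans ((mul_le_mul hi' hy1 (norm_nonneg _) (by positivity)).trans (le_of_eq ?_))
    field_simp
  have hge : 1 ≤ ‖∑ i ∈ range n, y ^ i‖ := by
    have h1 := norm_sub_le_norm_add (n : ℂ) (∑ i ∈ range n, (y ^ i - 1))
    rw [← hsum, Complex.norm_natCast] at h1
    linarith
  rw [← geom_sum_mul, norm_mul]
  exact le_mul_of_one_le_left (norm_nonneg _) hge

lemma norm_aeval_sub_aeval_le {A : ℤ[X]} {r : ℕ} {L : ℝ} (hA : A.natDegree ≤ r)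
    (hL : ∀ k, |(A.coeff k : ℝ)| ≤ L) {a b : ℂ} (ha : ‖a‖ ≤ 1) (hb : ‖b‖ ≤ 1) :
    ‖aeval a A - aeval b A‖ ≤ (r + 1) ^ 2 * L * ‖a - b‖ := by
  have hL0 : 0 ≤ L := (abs_nonneg _).trans (hL 0)
  rw [aeval_eq_sum_range' (n := r + 1) (by omega), aeval_eq_sum_range' (n := r + 1) (by omega),
    ← sum_sub_distrib]
  refine (norm_sum_le_of_le (n := fun _ => (r + 1) * L * ‖a - b‖) _ fun k hk => ?_).trans
    (le_of_eq ?_)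
  · rw [← smul_sub, zsmul_eq_mul, norm_mul, Complex.norm_intCast]
    have hk' : (k : ℝ) ≤ r + 1 := by exact_mod_cast (mem_range.mp hk).le
    calc |(A.coeff k : ℝ)| * ‖a ^ k - b ^ k‖ ≤ L * ((r + 1) * ‖a - b‖) := by
          refine mul_le_mul (hL k) ((norm_pow_sub_pow_le_mul ha hb k).trans ?_) (norm_nonneg _) hL0
          gcongr
      _ = _ := by ring
  · simp; ring

lemma IsPadePair.norm_sub_le {n r : ℕ} (hn : 2 ≤ n) {A B : ℤ[X]} (h : IsPadePair n r A B)
    {t y : ℂ} (ht : ‖t‖ = 1) (hy : ‖y‖ = 1) (hy1 : ‖y - 1‖ ≤ 1) :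
    ‖aeval t A - y * aeval t B‖ ≤ (16 * (n : ℝ) ^ (2 * n) * 4 ^ n) ^ (r + 1) *
      (‖y - 1‖ ^ (2 * r + 1) + ‖t - y ^ n‖) := by
  set L : ℝ := (16 * (n : ℝ) ^ (2 * n)) ^ (r + 1) with hL
  have hL0 : 0 ≤ L := by positivity
  have hAL : ∀ k, |(A.coeff k : ℝ)| ≤ L := fun k => by
    rw [hL]; exact_mod_cast h.abs_coeff_left k
  have hBL : ∀ k, |(B.coeff k : ℝ)| ≤ L := fun k => by
    rw [hL]; exact_mod_cast h.abs_coeff_right k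
  have hexpand : ∀ P : ℤ[X], (∀ k, |(P.coeff k : ℝ)| ≤ L) →
      ∀ k, |((expand ℤ n P).coeff k : ℝ)| ≤ L := by
    intro P hP k
    rw [coeff_expand (by omega)]
    split_ifs
    · exact hP _
    · simpa using hL0
  set G := expand ℤ n A - X * expand ℤ n B with hG
  have hGdeg : G.natDegree ≤ n * r + 1 := by
    refine (natDegree_sub_le _ _).trans (max_le ?_ (natDegree_mul_le.trans ?_))
    · rw [natDegree_expand]; nlinarith [h.natDegree_left]
    · rw [natDegree_expand, natDegree_X]; nlinarith [h.natDegree_right]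
  have hGL : ∀ k, |(G.coeff k : ℝ)| ≤ 2 * L := by
    intro k
    rw [hG, coeff_sub, Int.cast_sub, two_mul]
    refine (abs_sub _ _).trans (add_le_add (hexpand A hAL k) ?_)
    cases k with
    | zero => simpa using hL0
    | succ k => rw [coeff_X_mul]; exact hexpand B hBL k
  obtain ⟨H, -, hH⟩ := h.order_eq
  have h1 := norm_aeval_le_of_dvd hGdeg hGL ⟨H, hH⟩ hy1
  have hyn : ‖y ^ n‖ ≤ 1 := by rw [norm_pow, hy, one_pow]
  have h2 := norm_aeval_sub_aeval_le h.natDegree_left hAL ht.le hyn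
  have h3 := norm_aeval_sub_aeval_le h.natDegree_right hBL ht.le hyn
  have hsplit : aeval t A - y * aeval t B = aeval y G + (aeval t A - aeval (y ^ n) A) -
      y * (aeval t B - aeval (y ^ n) B) := by
    rw [hG, map_sub, map_mul, aeval_X, expand_aeval, expand_aeval]; ring
  have hr : (r : ℝ) + 1 ≤ 2 ^ r := by exact_mod_cast (Nat.lt_two_pow_self : r < 2 ^ r)
  have hnr : ((n * r + 1 : ℕ) : ℝ) + 1 ≤ 2 ^ (n * r + 1) := by
    exact_mod_cast (Nat.lt_two_pow_self : n * r + 1 < 2 ^ (n * r + 1))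
  have hc1 : (((n * r + 1 : ℕ) : ℝ) + 1) * 2 ^ (n * r + 1) * (2 * L) ≤
      (4 ^ n) ^ (r + 1) * L := by
    calc _ ≤ (2 ^ (n * r + 1) : ℝ) * 2 ^ (n * r + 1) * (2 * L) := by gcongr
      _ = 2 ^ (2 * (n * r) + 3) * L := by ring
      _ ≤ 2 ^ (2 * n * (r + 1)) * L := by
        gcongr
        · norm_num
        · nlinarith
      _ = _ := by rw [show (4 : ℝ) = 2 ^ 2 by norm_num, ← pow_mul, ← pow_mul, mul_assoc 2 n]
  have hc2 : ((r : ℝ) + 1) ^ 2 * L + (r + 1) ^ 2 * L ≤ (4 ^ n) ^ (r + 1) * L := by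
    calc ((r : ℝ) + 1) ^ 2 * L + (r + 1) ^ 2 * L = 2 * (r + 1) ^ 2 * L := by ring
      _ ≤ 2 * (2 ^ r) ^ 2 * L := by gcongr
      _ = 2 ^ (2 * r + 1) * L := by ring
      _ ≤ 2 ^ (2 * n * (r + 1)) * L := by
        gcongr
        · norm_num
        · nlinarith
      _ = _ := by rw [show (4 : ℝ) = 2 ^ 2 by norm_num, ← pow_mul, ← pow_mul, mul_assoc 2 n]
  rw [hsplit]
  calc _ ≤ ‖aeval y G‖ + ‖aeval t A - aeval (y ^ n) A‖ + ‖aeval t B - aeval (y ^ n) B‖ := by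
        refine (_root_.norm_sub_le _ _).trans ?_
        rw [norm_mul, hy, one_mul]
        gcongr
        exact norm_add_le _ _
    _ ≤ (((n * r + 1 : ℕ) : ℝ) + 1) * 2 ^ (n * r + 1) * (2 * L) * ‖y - 1‖ ^ (2 * r + 1) +
        (((r : ℝ) + 1) ^ 2 * L + (r + 1) ^ 2 * L) * ‖t - y ^ n‖ := by linarith
    _ ≤ (4 ^ n) ^ (r + 1) * L * ‖y - 1‖ ^ (2 * r + 1) + (4 ^ n) ^ (r + 1) * L * ‖t - y ^ n‖ := by
        gcongr
    _ = _ := by rw [hL, mul_pow (16 * (n : ℝ) ^ (2 * n))]; ring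

lemma pow_mul_aeval_div_mem (R : Subring ℂ) {A : ℤ[X]} {r : ℕ} (hA : A.natDegree ≤ r) {a b : ℂ}
    (ha : a ∈ R) (hb : b ∈ R) (hb0 : b ≠ 0) : b ^ r * aeval (a / b) A ∈ R := by
  rw [aeval_eq_sum_range' (n := r + 1) (by omega), mul_sum]
  refine R.sum_mem fun k hk => ?_
  have hk' : k ≤ r := Nat.lt_succ_iff.mp (mem_range.mp hk)
  have h : b ^ r * (A.coeff k • (a / b) ^ k) = A.coeff k • (a ^ k * b ^ (r - k)) := by
    rw [← Nat.sub_add_cancel hk', pow_add, Nat.add_sub_cancel, zsmul_eq_mul, zsmul_eq_mul, div_pow]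
    field_simp
  rw [h]
  exact R.zsmul_mem (R.mul_mem (R.pow_mem ha _) (R.pow_mem hb _)) _

open ComplexConjugate in
/-- The gap inequality between two elements `x₁`, `x₂` with the same trace `c` which are `n`-th
powers in a discrete subring, up to a common factor. -/
lemma one_le_of_eq_pow (R : Subring ℂ) (hconj : ∀ z ∈ R, conj z ∈ R)
    (hnorm : ∀ z ∈ R, z ≠ 0 → 1 ≤ ‖z‖) {n : ℕ} (hn : 2 ≤ n) {c : ℝ} (hc : 1 ≤ c)
    {x₁ x₂ g a₁ a₂ : ℂ} (hx₁ : x₁ ∈ R) (hg : g ≠ 0) (ha₁ : a₁ ∈ R)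
    (ha₂ : a₂ ∈ R) (h₁ : x₁ * g = a₁ ^ n) (h₂ : x₂ * g = a₂ ^ n) (ht₁ : x₁ + conj x₁ = c)
    (ht₂ : x₂ + conj x₂ = c) (hle : ‖x₁‖ ≤ ‖x₂‖)
    (hclose : ‖a₁ / conj a₁ / (a₂ / conj a₂) - 1‖ ≤ 1 / (2 * n)) (r : ℕ) :
    ∃ s, r ≤ s ∧ s ≤ r + 1 ∧ 1 ≤ (64 * c ^ 2 * (n : ℝ) ^ (2 * n) * 4 ^ n) ^ (s + 1) *
      (‖x₁‖ ^ s / ‖x₁‖ ^ (2 * s + 1) + ‖x₁‖ ^ s / ‖x₂‖) * (‖a₁‖ * ‖a₂‖) := by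
  have hc0 : (c : ℂ) ≠ 0 := by exact_mod_cast (by linarith : c ≠ 0)
  have hx₁0 : x₁ ≠ 0 := by rintro rfl; simp at ht₁; exact hc0 ht₁.symm
  have hx₂0 : x₂ ≠ 0 := by rintro rfl; simp at ht₂; exact hc0 ht₂.symm
  have hn0 : n ≠ 0 := by omega
  have ha₁0 : a₁ ≠ 0 := by
    rintro rfl; rw [zero_pow hn0] at h₁; exact mul_ne_zero hx₁0 hg h₁
  have ha₂0 : a₂ ≠ 0 := by
    rintro rfl; rw [zero_pow hn0] at h₂; exact mul_ne_zero hx₂0 hg h₂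
  have hcx : ∀ {z : ℂ}, z ≠ 0 → conj z ≠ 0 := fun hz => (_root_.map_ne_zero _).mpr hz
  have hX₁ : 0 < ‖x₁‖ := norm_pos_iff.mpr hx₁0
  have hX₂ : 0 < ‖x₂‖ := norm_pos_iff.mpr hx₂0
  set y : ℂ := a₁ / conj a₁ / (a₂ / conj a₂) with hy
  set t : ℂ := -x₁ / conj x₁ with ht
  have hynorm : ‖y‖ = 1 := by
    rw [hy]; simp [ha₁0, ha₂0]
  have htnorm : ‖t‖ = 1 := by rw [ht]; simp [hx₁0]
  have hyn : y ^ n = x₁ / conj x₁ / (x₂ / conj x₂) := by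
    have e₁ : conj x₁ * conj g = conj a₁ ^ n := by rw [← map_mul, h₁, map_pow]
    have e₂ : conj x₂ * conj g = conj a₂ ^ n := by rw [← map_mul, h₂, map_pow]
    rw [hy, div_pow, div_pow, div_pow, ← h₁, ← h₂, ← e₁, ← e₂]
    have := hcx hg
    have := hcx hx₁0
    have := hcx hx₂0
    field_simp
  have hty : ‖t - y ^ n‖ = c / ‖x₂‖ := by
    have : t - y ^ n = t * (c / x₂) := by
      rw [hyn, ht, ← ht₂]
      have := hcx hx₁0
      have := hcx hx₂0
      field_simp
      ring
    rw [this, norm_mul, htnorm, one_mul, norm_div, Complex.norm_real, Real.norm_of_nonneg (by linarith)]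
  have ht1 : t - 1 = -(c / conj x₁) := by
    rw [ht, ← ht₁]
    have := hcx hx₁0
    field_simp
    ring
  have htne : t ≠ 1 := by
    intro h
    rw [h, sub_self, eq_comm, neg_eq_zero] at ht1
    exact div_ne_zero hc0 (hcx hx₁0) ht1
  have hyδ : ‖y - 1‖ ≤ 2 * c / ‖x₁‖ := by
    refine (norm_sub_one_le_norm_pow_sub_one hn hynorm hclose).trans ?_
    have h1 : ‖t - 1‖ = c / ‖x₁‖ := by
      rw [ht1, norm_neg, norm_div, Complex.norm_real, RCLike.norm_conj,
        Real.norm_of_nonneg (by linarith)]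
    have h2 : c / ‖x₂‖ ≤ c / ‖x₁‖ := by gcongr
    calc ‖y ^ n - 1‖ = ‖(t - 1) - (t - y ^ n)‖ := by congr 1; ring
      _ ≤ ‖t - 1‖ + ‖t - y ^ n‖ := norm_sub_le _ _
      _ ≤ c / ‖x₁‖ + c / ‖x₁‖ := by rw [h1, hty]; gcongr
      _ = _ := by ring
  have hy1 : ‖y - 1‖ ≤ 1 := by
    refine hclose.trans ?_
    have hn' : (2 : ℝ) ≤ n := by exact_mod_cast hn
    rw [div_le_one (by positivity)]; linarith
  have main : ∀ (s : ℕ) (A B : ℤ[X]), IsPadePair n s A B → aeval t A - y * aeval t B ≠ 0 →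
      1 ≤ (64 * c ^ 2 * (n : ℝ) ^ (2 * n) * 4 ^ n) ^ (s + 1) *
      (‖x₁‖ ^ s / ‖x₁‖ ^ (2 * s + 1) + ‖x₁‖ ^ s / ‖x₂‖) * (‖a₁‖ * ‖a₂‖) := by
    intro s A B hAB hne
    set D : ℂ := (conj x₁ ^ s * aeval t A) * (conj a₁ * a₂) -
      (conj x₁ ^ s * aeval t B) * (a₁ * conj a₂) with hD
    have hDeq : D = conj x₁ ^ s * (conj a₁ * a₂) * (aeval t A - y * aeval t B) := by
      rw [hD, hy]
      have := hcx ha₁0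
      have := hcx ha₂0
      field_simp
    have hDR : D ∈ R := R.sub_mem
      (R.mul_mem (pow_mul_aeval_div_mem R hAB.natDegree_left (R.neg_mem hx₁) (hconj _ hx₁)
        (hcx hx₁0)) (R.mul_mem (hconj _ ha₁) ha₂))
      (R.mul_mem (pow_mul_aeval_div_mem R hAB.natDegree_right (R.neg_mem hx₁) (hconj _ hx₁)
        (hcx hx₁0)) (R.mul_mem ha₁ (hconj _ ha₂)))
    have hD0 : D ≠ 0 := by
      rw [hDeq]
      exact mul_ne_zero (mul_ne_zero (pow_ne_zero _ (hcx hx₁0)) (mul_ne_zero (hcx ha₁0) ha₂0)) hne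
    refine (hnorm D hDR hD0).trans ?_
    rw [hDeq, norm_mul, norm_mul, norm_mul, norm_pow, RCLike.norm_conj, RCLike.norm_conj]
    have hbase := hAB.norm_sub_le hn htnorm hynorm hy1
    have hpow : ‖y - 1‖ ^ (2 * s + 1) + ‖t - y ^ n‖ ≤
        (4 * c ^ 2) ^ (s + 1) * (1 / ‖x₁‖ ^ (2 * s + 1) + 1 / ‖x₂‖) := by
      have e1 : (2 * c) ^ (2 * s + 1) ≤ (4 * c ^ 2) ^ (s + 1) := by
        calc (2 * c) ^ (2 * s + 1) ≤ (2 * c) ^ (2 * (s + 1)) :=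
              pow_le_pow_right₀ (by linarith) (by omega)
          _ = _ := by rw [pow_mul]; ring
      have e2 : c ≤ (4 * c ^ 2) ^ (s + 1) := by
        calc c ≤ 4 * c ^ 2 := by nlinarith
          _ ≤ _ := le_self_pow₀ (by nlinarith) (by omega)
      rw [hty, mul_add]
      refine add_le_add ?_ ?_
      · calc ‖y - 1‖ ^ (2 * s + 1) ≤ (2 * c / ‖x₁‖) ^ (2 * s + 1) := by gcongr
          _ = (2 * c) ^ (2 * s + 1) * (1 / ‖x₁‖ ^ (2 * s + 1)) := by rw [div_pow]; ring
          _ ≤ _ := by gcongr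
      · calc c / ‖x₂‖ = c * (1 / ‖x₂‖) := by ring
          _ ≤ _ := by gcongr
    calc _ ≤ ‖x₁‖ ^ s * (‖a₁‖ * ‖a₂‖) * ((16 * (n : ℝ) ^ (2 * n) * 4 ^ n) ^ (s + 1) *
          ((4 * c ^ 2) ^ (s + 1) * (1 / ‖x₁‖ ^ (2 * s + 1) + 1 / ‖x₂‖))) := by
          gcongr
          exact hbase.trans (by gcongr)
      _ = _ := by
          rw [show 64 * c ^ 2 * (n : ℝ) ^ (2 * n) * 4 ^ n =
            (16 * (n : ℝ) ^ (2 * n) * 4 ^ n) * (4 * c ^ 2) by ring, mul_pow _ (4 * c ^ 2)]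
          ring
  obtain ⟨A, B, hAB⟩ := exists_isPadePair hn r
  obtain ⟨A', B', hAB'⟩ := exists_isPadePair hn (r + 1)
  by_cases h0 : aeval t A - y * aeval t B = 0
  · refine ⟨r + 1, by omega, le_rfl, main _ A' B' hAB' fun h0' => ?_⟩
    refine hAB.det_ne_zero hn hAB' htne ?_
    linear_combination aeval t B' * h0 - aeval t B * h0'
  · exact ⟨r, le_rfl, by omega, main _ A B hAB h0⟩

lemma exists_forall_exists_mul_eq_pow {R : Type*} [CommRing R] [IsDedekindDomain R]
    (c : ClassGroup R) (n : ℕ) : ∃ g : R, g ≠ 0 ∧ ∀ (I : (nonZeroDivisors (Ideal R))) (x : R),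
      ClassGroup.mk0 I = c → Ideal.span {x} = (I : Ideal R) ^ n →
      ∃ (u : Rˣ) (a : R), x * (g * u) = a ^ n := by
  obtain ⟨J, hJ⟩ := ClassGroup.mk0_surjective c⁻¹
  by_cases hc : c ^ n = 1
  · have h1 : ClassGroup.mk0 (J ^ n) = 1 := by rw [map_pow, hJ, inv_pow, hc, inv_one]
    have h2 := (ClassGroup.mk0_eq_one_iff (J ^ n).2).1 h1
    obtain ⟨g, hg⟩ := (Submodule.isPrincipal_iff _).1 h2
    have hg' : (J : Ideal R) ^ n = Ideal.span {g} := by simpa using hg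
    have hJ0 : (J : Ideal R) ≠ 0 := nonZeroDivisors.coe_ne_zero _
    refine ⟨g, ?_, fun I x hI hx => ?_⟩
    · rintro rfl
      rw [Ideal.span_singleton_eq_bot.2 rfl] at hg'
      exact pow_ne_zero n hJ0 hg'
    · obtain ⟨a, -, ha⟩ := ClassGroup.mk0_eq_mk0_inv_iff.1
        (show ClassGroup.mk0 I = (ClassGroup.mk0 J)⁻¹ by rw [hI, hJ, inv_inv])
      have h3 : Ideal.span {x * g} = Ideal.span {a ^ n} := by
        rw [← Ideal.span_singleton_mul_span_singleton, hx, ← hg', ← mul_pow, ha,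
          Ideal.span_singleton_pow]
      obtain ⟨u, hu⟩ := Ideal.span_singleton_eq_span_singleton.1 h3
      exact ⟨u, a, by rw [← hu, mul_assoc]⟩
  · refine ⟨1, one_ne_zero, fun I x hI hx => absurd ?_ hc⟩
    rw [← hI, ← map_pow, ClassGroup.mk0_eq_one_iff (I ^ n).2]
    exact ⟨x, by simpa using hx.symm⟩

/-- Infinitely many coprime factors of `n`-th powers become `n`-th powers after multiplication by a
single nonzero element, when the class group and the unit group are finite. -/
lemma exists_infinite_mul_eq_pow {R : Type*} [CommRing R] [IsDedekindDomain R]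
    [Finite (ClassGroup R)] [Finite Rˣ] {n : ℕ} {T : Set R} (hT : T.Infinite)
    (h : ∀ x ∈ T, x ≠ 0 ∧ ∃ y m, IsCoprime x y ∧ x * y = m ^ n) (hn : n ≠ 0) :
    ∃ g : R, g ≠ 0 ∧ {x ∈ T | ∃ a, x * g = a ^ n}.Infinite := by
  choose g hg0 hg using fun c : ClassGroup R => exists_forall_exists_mul_eq_pow c n
  by_contra! hcon
  refine hT ((Set.finite_iUnion fun cu : ClassGroup R × Rˣ =>
    hcon (g cu.1 * cu.2) (mul_ne_zero (hg0 _) cu.2.ne_zero)).subset ?_)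
  intro x hx
  obtain ⟨hx0, y, m, hxy, hm⟩ := h x hx
  obtain ⟨I, hI⟩ := exists_eq_pow_of_mul_eq_pow_of_coprime (R := Ideal R)
    (a := Ideal.span {x}) (b := Ideal.span {y}) (c := Ideal.span {m}) (n := n)
    ((Ideal.isCoprime_span_singleton_iff x y).2 hxy)
    (by rw [Ideal.span_singleton_mul_span_singleton, hm, Ideal.span_singleton_pow])
  have hI0 : I ∈ nonZeroDivisors (Ideal R) := by
    refine mem_nonZeroDivisors_of_ne_zero ?_
    rintro rfl
    rw [zero_pow hn] at hI
    exact hx0 (Ideal.span_singleton_eq_bot.1 hI)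
  obtain ⟨u, a, ha⟩ := hg _ ⟨I, hI0⟩ x rfl hI
  exact Set.mem_iUnion.2 ⟨(ClassGroup.mk0 ⟨I, hI0⟩, u), hx, a, ha⟩

lemma exists_forall_not_one_le {K G : ℝ} (hK : 1 ≤ K) (hG : 0 ≤ G) :
    ∃ X₀, 1 ≤ X₀ ∧ ∀ X₁ ≥ X₀, ∃ Y, ∀ X₂ ≥ Y, ∀ w ≥ 0, w ^ 3 ≤ G * (X₁ * X₂) →
      ¬ ∀ r : ℕ, ∃ s, r ≤ s ∧ s ≤ r + 1 ∧
        1 ≤ K ^ (s + 1) * (X₁ ^ s / X₁ ^ (2 * s + 1) + X₁ ^ s / X₂) * w := by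
  have hK3 : 1 ≤ K ^ 3 := one_le_pow₀ hK
  refine ⟨2 * K ^ 3, by linarith, fun X₁ h₁ => ?_⟩
  have hX : 2 ≤ X₁ := by linarith
  have hX0 : 0 < X₁ := by linarith
  set M := 8 * G * K ^ 6 * X₁ ^ 6 with hM
  obtain ⟨R, hR⟩ := pow_unbounded_of_one_lt M (one_lt_two (α := ℝ))
  refine ⟨X₁ ^ (2 * (R + 1)), fun X₂ h₂ w hw hw3 hcon => ?_⟩
  have hX2 : 1 ≤ X₁ ^ 2 := one_le_pow₀ (by linarith)
  have h2pos : 0 < X₂ := lt_of_lt_of_le (by positivity) h₂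
  obtain ⟨r, hr1, hr2⟩ := exists_nat_pow_near (x := X₂) (y := X₁ ^ 2)
    ((one_le_pow₀ (by linarith)).trans h₂) (by nlinarith)
  have hRr : R ≤ r := by
    by_contra! hlt
    refine absurd (h₂.trans_lt hr2) (not_lt.2 ?_)
    rw [← pow_mul]
    exact pow_le_pow_right₀ (by linarith) (by omega)
  obtain ⟨s, hs1, hs2, hs⟩ := hcon r
  have hb1 : X₁ ^ s / X₁ ^ (2 * s + 1) ≤ X₁ / X₁ ^ r := by
    rw [div_le_div_iff₀ (by positivity) (by positivity), ← pow_add, ← pow_succ']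
    exact pow_le_pow_right₀ (by linarith) (by omega)
  have hb2 : X₁ ^ s / X₂ ≤ X₁ / X₁ ^ r := by
    rw [div_le_div_iff₀ (by positivity) (by positivity), ← pow_add]
    calc X₁ ^ (s + r) ≤ X₁ ^ (2 * r + 1) := pow_le_pow_right₀ (by linarith) (by omega)
      _ = X₁ * (X₁ ^ 2) ^ r := by ring
      _ ≤ X₁ * X₂ := by gcongr
  have h1 : X₁ ^ r ≤ K ^ (r + 2) * (2 * X₁) * w := by
    have : 1 ≤ K ^ (r + 2) * (X₁ / X₁ ^ r + X₁ / X₁ ^ r) * w := by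
      have hKs : K ^ (s + 1) ≤ K ^ (r + 2) := pow_le_pow_right₀ hK (by omega)
      exact hs.trans (by gcongr)
    have e : K ^ (r + 2) * (X₁ / X₁ ^ r + X₁ / X₁ ^ r) * w =
        K ^ (r + 2) * (2 * X₁) * w / X₁ ^ r := by ring
    rw [e, le_div_iff₀ (by positivity), one_mul] at this
    exact this
  have h3 : X₁ ^ r * X₁ ^ (2 * r) ≤ M * K ^ (3 * r) * X₁ ^ (2 * r) := by
    calc X₁ ^ r * X₁ ^ (2 * r) = (X₁ ^ r) ^ 3 := by ring
      _ ≤ (K ^ (r + 2) * (2 * X₁) * w) ^ 3 := by gcongr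
      _ = 8 * K ^ (3 * r + 6) * X₁ ^ 3 * w ^ 3 := by ring
      _ ≤ 8 * K ^ (3 * r + 6) * X₁ ^ 3 * (G * (X₁ * (X₁ ^ 2) ^ (r + 1))) := by
        gcongr
        exact hw3.trans (by gcongr)
      _ = M * K ^ (3 * r) * X₁ ^ (2 * r) := by rw [hM]; ring
  have h4 := le_of_mul_le_mul_right h3 (by positivity)
  have h5 : 2 ^ r * K ^ (3 * r) ≤ M * K ^ (3 * r) := by
    refine le_trans ?_ h4
    rw [pow_mul, ← mul_pow]
    gcongr
  have h6 := le_of_mul_le_mul_right h5 (by positivity)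
  have h7 : (2 : ℝ) ^ R ≤ 2 ^ r := pow_le_pow_right₀ (by norm_num) hRr
  linarith

open ComplexConjugate in
/-- The ring of integers of the imaginary quadratic field `ℚ(√-N)`, embedded in `ℂ`. -/
lemma exists_quadratic_integers {N : ℕ} (hN : 0 < N) {s : ℂ}
    (hs : s ^ 2 = -N) (hsc : conj s = -s) :
    ∃ (O : Type) (_ : CommRing O) (_ : IsDedekindDomain O) (ι : O →+* ℂ),
      Function.Injective ι ∧ Finite (ClassGroup O) ∧ Finite Oˣ ∧ (∃ σ, ι σ = s) ∧
      (∀ z, ∃ z', ι z' = conj (ι z)) ∧ ∀ z, z ≠ 0 → 1 ≤ ‖ι z‖ := by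
  have hsint : IsIntegral ℤ s :=
    IsIntegral.of_pow two_pos (by rw [hs]; exact (isIntegral_natCast (R := ℤ) N).neg)
  let K := IntermediateField.adjoin ℚ {s}
  have : FiniteDimensional ℚ K := IntermediateField.adjoin.finiteDimensional hsint.tower_top
  have : NumberField K := ⟨⟩
  have hrep : ∀ z ∈ K, ∃ a b : ℚ, z = a + b * s := by
    intro z hz
    induction hz using IntermediateField.adjoin_induction with
    | mem x hx =>
      rw [Set.mem_singleton_iff] at hx
      exact ⟨0, 1, by simp [hx]⟩
    | algebraMap x => exact ⟨x, 0, by simp⟩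
    | add x y _ _ hx hy =>
      obtain ⟨a, b, rfl⟩ := hx
      obtain ⟨a', b', rfl⟩ := hy
      exact ⟨a + a', b + b', by push_cast; ring⟩
    | mul x y _ _ hx hy =>
      obtain ⟨a, b, rfl⟩ := hx
      obtain ⟨a', b', rfl⟩ := hy
      refine ⟨a * a' - N * (b * b'), a * b' + a' * b, ?_⟩
      push_cast
      linear_combination (b * b' : ℂ) * hs
    | inv x _ hx =>
      obtain ⟨a, b, rfl⟩ := hx
      by_cases h : a ^ 2 + N * b ^ 2 = 0
      · have hN' : (0 : ℚ) < N := by exact_mod_cast hN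
        have hb : b = 0 := by
          by_contra hb
          have : 0 < N * b ^ 2 := by positivity
          nlinarith [sq_nonneg a]
        have ha : a = 0 := by simpa [hb] using h
        exact ⟨0, 0, by simp [ha, hb]⟩
      · have h' : (a ^ 2 + N * b ^ 2 : ℂ) ≠ 0 := by exact_mod_cast h
        refine ⟨a / (a ^ 2 + N * b ^ 2), -b / (a ^ 2 + N * b ^ 2), ?_⟩
        refine inv_eq_of_mul_eq_one_right ?_
        push_cast
        rw [← mul_right_inj' h']
        field_simp
        linear_combination (-b ^ 2 : ℂ) * hs
  have hconjrep : ∀ a b : ℚ, conj (a + b * s : ℂ) = a - b * s := by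
    intro a b
    simp [hsc]
    ring
  have hnormrep : ∀ a b : ℚ, ((a + b * s) * (a - b * s) : ℂ) = ((a ^ 2 + N * b ^ 2 : ℚ) : ℂ) := by
    intro a b
    push_cast
    linear_combination (-b ^ 2 : ℂ) * hs
  have hsK : s ∈ K := IntermediateField.mem_adjoin_simple_self ℚ s
  have hconjK : ∀ z ∈ K, conj z ∈ K := by
    intro z hz
    obtain ⟨a, b, rfl⟩ := hrep z hz
    rw [hconjrep]
    exact sub_mem (SubfieldClass.ratCast_mem K a) (mul_mem (SubfieldClass.ratCast_mem K b) hsK)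
  let ι : NumberField.RingOfIntegers K →+* ℂ := K.val.toRingHom.comp (algebraMap _ K)
  have hι : Function.Injective ι :=
    K.val.injective.comp (NumberField.RingOfIntegers.coe_injective)
  have hιint : ∀ z, IsIntegral ℤ (ι z) := fun z =>
    (NumberField.RingOfIntegers.isIntegral_coe z).map (K.val.restrictScalars ℤ)
  have hlift : ∀ z ∈ K, IsIntegral ℤ z → ∃ w, ι w = z := by
    intro z hz hzi
    refine ⟨⟨⟨z, hz⟩, ?_⟩, rfl⟩
    exact (isIntegral_algHom_iff (K.val.restrictScalars ℤ) K.val.injective).1 hzi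
  have hιK : ∀ z, ι z ∈ K := fun z => (algebraMap (NumberField.RingOfIntegers K) K z).2
  have hconjint : ∀ z : ℂ, IsIntegral ℤ z → IsIntegral ℤ (conj z) := fun z hz =>
    hz.map (Complex.conjAe.toAlgHom.restrictScalars ℤ)
  have hnorm : ∀ z, z ≠ 0 → 1 ≤ ‖ι z‖ := by
    intro z hz
    obtain ⟨a, b, hab⟩ := hrep _ (hιK z)
    have h1 : IsIntegral ℤ (ι z * conj (ι z)) := (hιint z).mul (hconjint _ (hιint z))
    have h2 : ι z * conj (ι z) = ((a ^ 2 + N * b ^ 2 : ℚ) : ℂ) := by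
      rw [hab, hconjrep, hnormrep]
    have h3 : IsIntegral ℤ (a ^ 2 + N * b ^ 2 : ℚ) := by
      rw [h2] at h1
      exact (isIntegral_algebraMap_iff (algebraMap ℚ ℂ).injective).1 h1
    obtain ⟨k, hk⟩ := IsIntegrallyClosed.isIntegral_iff.1 h3
    have h4 : ((‖ι z‖ ^ 2 : ℝ) : ℂ) = ((k : ℝ) : ℂ) := by
      rw [Complex.ofReal_pow, ← Complex.mul_conj', h2, ← hk]
      simp
    have h5 : ‖ι z‖ ^ 2 = k := Complex.ofReal_injective h4
    have h6 : 0 < ‖ι z‖ := norm_pos_iff.2 fun h => hz (hι (by rw [h, map_zero]))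
    have h7 : (1 : ℝ) ≤ k := by
      have : (0 : ℝ) < k := by rw [← h5]; positivity
      exact_mod_cast this
    nlinarith
  refine ⟨NumberField.RingOfIntegers K, inferInstance, inferInstance, ι, hι, inferInstance, ?_,
    hlift s hsK hsint, fun z => hlift _ (hconjK _ (hιK z)) (hconjint _ (hιint z)), hnorm⟩
  have hφ : ∀ (φ : K →+* ℂ) (z : K), ‖φ z‖ = ‖(z : ℂ)‖ := by
    intro φ z
    obtain ⟨a, b, hab⟩ := hrep _ z.2
    have hz : z = a + b * ⟨s, hsK⟩ := by
      ext
      simpa using hab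
    have h1 : φ ⟨s, hsK⟩ ^ 2 = s ^ 2 := by
      have : (⟨s, hsK⟩ : K) ^ 2 = -N := by
        ext
        simpa using hs
      rw [← map_pow, this, hs]
      simp
    have h2 : φ z = a + b * φ ⟨s, hsK⟩ := by
      rw [hz]
      simp
    rcases sq_eq_sq_iff_eq_or_eq_neg.1 h1 with h | h
    · rw [h2, h, hab]
    · rw [h2, h, hab, ← Complex.norm_conj (a + b * s), hconjrep, mul_neg,
        ← sub_eq_add_neg]
  have hu : ∀ u : (NumberField.RingOfIntegers K)ˣ, ‖ι u‖ = 1 := by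
    intro u
    have h1 := hnorm u u.ne_zero
    have h2 := hnorm (u⁻¹ : (NumberField.RingOfIntegers K)ˣ) (u⁻¹).ne_zero
    have h3 : ‖ι u‖ * ‖ι (u⁻¹ : (NumberField.RingOfIntegers K)ˣ)‖ = 1 := by
      rw [← norm_mul, ← map_mul, Units.mul_inv, map_one, norm_one]
    nlinarith
  have hfin := NumberField.Embeddings.finite_of_norm_le K ℂ 1
  refine @Finite.of_injective _ {x : K | IsIntegral ℤ x ∧ ∀ φ : K →+* ℂ, ‖φ x‖ ≤ 1}
    hfin (fun u => ⟨algebraMap _ K (u : NumberField.RingOfIntegers K),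
      NumberField.RingOfIntegers.isIntegral_coe _, fun φ => ?_⟩) ?_
  · rw [hφ]
    exact (hu u).le
  · intro u v huv
    refine Units.ext (NumberField.RingOfIntegers.coe_injective ?_)
    exact Subtype.mk.inj huv

lemma Set.Infinite.exists_subset_dist_lt {α X : Type*} [PseudoMetricSpace X] {T : Set α}
    (hT : T.Infinite) {B : Set X} (hB : TotallyBounded B) (f : α → X) (hf : ∀ x ∈ T, f x ∈ B)
    {ε : ℝ} (hε : 0 < ε) :
    ∃ S ⊆ T, S.Infinite ∧ ∀ x ∈ S, ∀ y ∈ S, dist (f x) (f y) < ε := by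
  obtain ⟨t, ht, htB⟩ := Metric.totallyBounded_iff.1 hB (ε / 2) (half_pos hε)
  have hsub : T ⊆ ⋃ c ∈ t, {x ∈ T | f x ∈ Metric.ball c (ε / 2)} := by
    intro x hx
    obtain ⟨c, hc, hxc⟩ := Set.mem_iUnion₂.1 (htB (hf x hx))
    exact Set.mem_biUnion hc ⟨hx, hxc⟩
  have : ∃ c ∈ t, {x ∈ T | f x ∈ Metric.ball c (ε / 2)}.Infinite := by
    by_contra! h
    exact hT ((ht.biUnion h).subset hsub)
  obtain ⟨c, -, hc⟩ := this
  refine ⟨_, Set.sep_subset _ _, hc, fun x hx y hy => ?_⟩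
  have h1 : dist (f x) c < ε / 2 := hx.2
  have h2 : dist (f y) c < ε / 2 := hy.2
  linarith [dist_triangle_right (f x) (f y) c]

open ComplexConjugate in
lemma finite_setOf_prime_pow_eq_sq_add {n q D : ℕ} (hn : 3 ≤ n) (hq : q ≠ 0) (hD : 0 < D) :
    {p : ℕ | p.Prime ∧ ∃ m : ℕ, p ^ n = q ^ 2 + m ^ 2 * D}.Finite := by
  have hs : ((√D : ℝ) * Complex.I : ℂ) ^ 2 = -D := by
    rw [mul_pow, Complex.I_sq, ← Complex.ofReal_pow, Real.sq_sqrt (Nat.cast_nonneg D)]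
    simp
  have hsc : conj ((√D : ℝ) * Complex.I : ℂ) = -((√D : ℝ) * Complex.I) := by
    rw [map_mul, Complex.conj_ofReal, Complex.conj_I, mul_neg]
  obtain ⟨O, _, _, ι, hι, _, _, ⟨σ, hσ⟩, hconj, hnorm⟩ := exists_quadratic_integers hD hs hsc
  by_contra hinf
  set P := {p : ℕ | p.Prime ∧ ∃ m : ℕ, p ^ n = q ^ 2 + m ^ 2 * D} \ Set.Iic (2 * q)
  have hP : P.Infinite := Set.Infinite.sdiff hinf (Set.finite_Iic _)
  have hPm : ∀ p ∈ P, ∃ m : ℕ, p ^ n = q ^ 2 + m ^ 2 * D := fun p hp => hp.1.2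
  choose! m hm using hPm
  let ξ : ℕ → O := fun p => q + m p * σ
  have hσ2 : σ ^ 2 = -D := hι (by rw [map_pow, hσ, hs]; simp)
  have hmul : ∀ p ∈ P, ξ p * (q - m p * σ) = (p : O) ^ n := by
    intro p hp
    have h : (p : O) ^ n = q ^ 2 + m p ^ 2 * D := by
      exact_mod_cast congrArg (Nat.cast (R := O)) (hm p hp)
    linear_combination (-(m p : O) ^ 2) * hσ2 - h
  have hιconj : ∀ p, conj (ι (ξ p)) = ι (q - m p * σ) := by
    intro p
    simp only [ξ, map_add, map_sub, map_mul, map_natCast, hσ, hsc]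
    ring
  have hsq : ∀ p ∈ P, ‖ι (ξ p)‖ ^ 2 = (p : ℝ) ^ n := by
    intro p hp
    have h : ((‖ι (ξ p)‖ ^ 2 : ℝ) : ℂ) = (((p : ℝ) ^ n : ℝ) : ℂ) := by
      rw [Complex.ofReal_pow, ← Complex.mul_conj', hιconj, ← map_mul, hmul p hp]
      simp
    exact Complex.ofReal_injective h
  have htr : ∀ p, ι (ξ p) + conj (ι (ξ p)) = ((2 * q : ℝ) : ℂ) := by
    intro p
    rw [hιconj, ← map_add]
    simp only [ξ, map_add, map_sub, map_mul, map_natCast]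
    push_cast
    ring
  have hinj : Set.InjOn ξ P := by
    intro p hp p' hp' h
    have h1 : (p : ℝ) ^ n = (p' : ℝ) ^ n := by rw [← hsq p hp, ← hsq p' hp', h]
    exact Nat.pow_left_injective (n := n) (by omega) (by exact_mod_cast h1)
  have hT : (ξ '' P).Infinite := hP.image hinj
  have hT0 : ∀ x ∈ ξ '' P, x ≠ 0 := by
    rintro _ ⟨p, hp, rfl⟩ h0
    have h1 := hsq p hp
    have h2 : (0 : ℝ) < p := Nat.cast_pos.2 hp.1.1.pos
    rw [h0, map_zero, norm_zero, zero_pow two_ne_zero] at h1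
    exact (pow_pos h2 n).ne h1
  obtain ⟨g, hg, hS⟩ := exists_infinite_mul_eq_pow (n := n) hT (fun x hx => ⟨hT0 x hx, by
    obtain ⟨p, hp, rfl⟩ := hx
    refine ⟨q - m p * σ, p, ?_, hmul p hp⟩
    have hcop : IsCoprime ((2 * q : ℕ) : ℤ) ((p ^ n : ℕ) : ℤ) := by
      refine Nat.isCoprime_iff_coprime.2 (Nat.Coprime.pow_right n ?_)
      refine ((Nat.Prime.coprime_iff_not_dvd hp.1.1).2 fun hdvd => hp.2 ?_).symm
      exact Nat.le_of_dvd (by omega) hdvd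
    obtain ⟨u, v, huv⟩ := hcop.map (Int.castRingHom O)
    refine ⟨u, u + v * ξ p, ?_⟩
    have h := hmul p hp
    push_cast [eq_intCast] at huv
    linear_combination huv + v * h⟩) (by omega)
  choose! a ha using fun x (hx : x ∈ {x ∈ ξ '' P | ∃ a, x * g = a ^ n}) => hx.2
  have ha0 : ∀ x ∈ {x ∈ ξ '' P | ∃ a, x * g = a ^ n}, a x ≠ 0 := by
    intro x hx h0
    have h := ha x hx
    rw [h0, zero_pow (by omega)] at h
    exact mul_ne_zero (hT0 x hx.1) hg h
  have hn0 : (0 : ℝ) < n := by exact_mod_cast (show 0 < n by omega)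
  have hunit : ∀ z : ℂ, z ≠ 0 → ‖z / conj z‖ = 1 := fun z hz => by
    rw [norm_div, Complex.norm_conj, div_self (norm_ne_zero_iff.2 hz)]
  have hιa0 : ∀ x ∈ {x ∈ ξ '' P | ∃ a, x * g = a ^ n}, ι (a x) ≠ 0 := fun x hx =>
    (map_ne_zero_iff ι hι).2 (ha0 x hx)
  obtain ⟨S, hST, hSinf, hclose⟩ := hS.exists_subset_dist_lt
    (isCompact_closedBall (0 : ℂ) 1).totallyBounded (fun x => ι (a x) / conj (ι (a x)))
    (fun x hx => mem_closedBall_zero_iff.2 (hunit _ (hιa0 x hx)).le)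
    (show 0 < 1 / (2 * (n : ℝ)) by positivity)
  have hbig : ∀ M : ℝ, ∃ x ∈ S, M ≤ ‖ι x‖ := by
    intro M
    by_contra! hM
    refine hSinf (((Set.finite_Iic ⌊M ^ 2⌋₊).image ξ).subset fun x hx => ?_)
    obtain ⟨p, hp, rfl⟩ := (hST hx).1
    refine ⟨p, Nat.le_floor ?_, rfl⟩
    calc (p : ℝ) ≤ (p : ℝ) ^ n :=
          le_self_pow₀ (Nat.one_le_cast.2 hp.1.1.one_lt.le) (by omega)
      _ = ‖ι (ξ p)‖ ^ 2 := (hsq p hp).symm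
      _ ≤ M ^ 2 := by gcongr; exact (hM _ hx).le
  have hq1 : (1 : ℝ) ≤ q := Nat.one_le_cast.2 (Nat.pos_of_ne_zero hq)
  have hn1 : (1 : ℝ) ≤ n := Nat.one_le_cast.2 (by omega)
  have hK : 1 ≤ 64 * (2 * q : ℝ) ^ 2 * (n : ℝ) ^ (2 * n) * 4 ^ n := by
    have h1 : (1 : ℝ) ≤ 64 * (2 * q : ℝ) ^ 2 := by nlinarith
    have h2 : (1 : ℝ) ≤ (n : ℝ) ^ (2 * n) := one_le_pow₀ hn1
    have h3 : (1 : ℝ) ≤ 4 ^ n := one_le_pow₀ (by norm_num)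
    exact one_le_mul_of_one_le_of_one_le (one_le_mul_of_one_le_of_one_le h1 h2) h3
  obtain ⟨X₀, -, hX₀⟩ := exists_forall_not_one_le hK (sq_nonneg ‖ι g‖)
  obtain ⟨x₁, hx₁, hX₁⟩ := hbig X₀
  obtain ⟨Y, hY⟩ := hX₀ _ hX₁
  obtain ⟨x₂, hx₂, hX₂⟩ := hbig (max Y ‖ι x₁‖)
  have hpow : ∀ x ∈ S, ι x * ι g = ι (a x) ^ n := fun x hx => by
    rw [← map_mul, ha x (hST hx), map_pow]
  have htrS : ∀ x ∈ S, ι x + conj (ι x) = ((2 * q : ℝ) : ℂ) := fun x hx => by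
    obtain ⟨p, -, rfl⟩ := (hST hx).1
    exact htr p
  have hw1 : 1 ≤ ‖ι (a x₁)‖ * ‖ι (a x₂)‖ :=
    one_le_mul_of_one_le_of_one_le (hnorm _ (ha0 _ (hST hx₁))) (hnorm _ (ha0 _ (hST hx₂)))
  refine hY ‖ι x₂‖ ((le_max_left _ _).trans hX₂) (‖ι (a x₁)‖ * ‖ι (a x₂)‖) (by positivity) ?_ ?_
  · calc (‖ι (a x₁)‖ * ‖ι (a x₂)‖) ^ 3 ≤ (‖ι (a x₁)‖ * ‖ι (a x₂)‖) ^ n :=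
          pow_le_pow_right₀ hw1 hn
      _ = ‖ι (a x₁) ^ n‖ * ‖ι (a x₂) ^ n‖ := by rw [mul_pow, norm_pow, norm_pow]
      _ = ‖ι g‖ ^ 2 * (‖ι x₁‖ * ‖ι x₂‖) := by
        rw [← hpow x₁ hx₁, ← hpow x₂ hx₂, norm_mul, norm_mul]
        ring
  · have hR : ∀ z ∈ ι.range, conj z ∈ ι.range := by
      rintro _ ⟨z, rfl⟩
      exact hconj z
    have hRn : ∀ z ∈ ι.range, z ≠ 0 → 1 ≤ ‖z‖ := by
      rintro _ ⟨z, rfl⟩ hz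
      exact hnorm z fun h => hz (by rw [h, map_zero])
    refine one_le_of_eq_pow ι.range hR hRn (by omega) (by linarith) ⟨x₁, rfl⟩
      ((map_ne_zero_iff ι hι).2 hg) ⟨a x₁, rfl⟩ ⟨a x₂, rfl⟩ (hpow x₁ hx₁) (hpow x₂ hx₂)
      (htrS x₁ hx₁) (htrS x₂ hx₂) ((le_max_right _ _).trans hX₂) ?_
    have h2 := hunit _ (hιa0 _ (hST hx₂))
    have h3 : ι (a x₂) / conj (ι (a x₂)) ≠ 0 := norm_ne_zero_iff.1 (by rw [h2]; exact one_ne_zero)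
    have h4 := (hclose x₁ hx₁ x₂ hx₂).le
    rw [dist_eq_norm] at h4
    rwa [div_sub_one h3, norm_div, h2, div_one]

end

/-- Let `n ≥ 3` be odd, `q` an odd prime, and `d < 0` a fixed square-free integer.  Then there
are only finitely many primes `p` for which `q² − pⁿ = m²d` for some positive integer `m`. -/
theorem finitely_many_p_with_squarefree_part_d
    (n : ℕ) (hn : 3 ≤ n) (hnodd : Odd n)
    (q : ℕ) (hq : q.Prime) (hqodd : Odd q)
    (d : ℤ) (hdneg : d < 0) (hdsf : Squarefree d) :
    {p : ℕ | p.Prime ∧ ∃ m : ℕ, 0 < m ∧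
      (q : ℤ) ^ 2 - (p : ℤ) ^ n = (m : ℤ) ^ 2 * d}.Finite := by
  obtain ⟨D, rfl⟩ : ∃ D : ℕ, d = -D := ⟨d.natAbs, by omega⟩
  refine (finite_setOf_prime_pow_eq_sq_add (D := D) hn hq.ne_zero (by omega)).subset ?_
  rintro p ⟨hp, m, -, hm⟩
  refine ⟨hp, m, ?_⟩
  zify
  linear_combination -hm
end
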